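/- arXiv:2010.12311 — 3 statements merged into one kernel-verified Lean document; each statement's English description precedes it below -/
import Mathlib

section
/- Let N ≥ 3, λ ∈ ℝ, m ≥ 2, and let u be a radial solution of the Brezis–Nirenberg problem on the unit ball with m nodal zones for the parameter λ, with first zero r_λ. Then sup_{r_λ ≤ r ≤ 1} |u(r)| ≤ −(1/(N−2))·r_λ·u'(r_λ). -/
open Real Set Filter Topology

/-- A radial solution of the Brezis–Nirenberg problem `-Δu = |u|^{4/(N-2)} u + λ u`
on the unit ball of `ℝ^N` with `m` nodal zones: a `C²` function `u` on `[0,1]`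
(given together with its first and second derivatives `u'`, `u''`) satisfying the
radial ODE, `u'(0) = 0`, `u(1) = 0`, `u(0) > 0`, with exactly `m - 1` zeros in `(0,1)`. -/
structure BNSol (N : ℕ) (lam : ℝ) (m : ℕ) (u u' u'' : ℝ → ℝ) : Prop where
  deriv_fst : ∀ r ∈ Set.Icc (0:ℝ) 1, HasDerivWithinAt u (u' r) (Set.Icc (0:ℝ) 1) r
  deriv_snd : ∀ r ∈ Set.Icc (0:ℝ) 1, HasDerivWithinAt u' (u'' r) (Set.Icc (0:ℝ) 1) r
  cont_snd : ContinuousOn u'' (Set.Icc (0:ℝ) 1)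
  ode : ∀ r ∈ Set.Ioo (0:ℝ) 1,
    u'' r + (((N:ℝ) - 1) / r) * u' r + |u r| ^ ((4:ℝ) / ((N:ℝ) - 2)) * u r + lam * u r = 0
  bc_deriv_zero : u' 0 = 0
  bc_one : u 1 = 0
  pos_zero : 0 < u 0
  nodal : {r : ℝ | r ∈ Set.Ioo (0:ℝ) 1 ∧ u r = 0}.ncard = m - 1

/-- `ρ` is the first zero of `u` in `(0,1]`. -/
def IsFirstZero (u : ℝ → ℝ) (ρ : ℝ) : Prop :=
  ρ ∈ Set.Ioc (0:ℝ) 1 ∧ u ρ = 0 ∧ ∀ s ∈ Set.Ioo (0:ℝ) ρ, u s ≠ 0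

lemma aux_G (p : ℝ) (hp : 0 < p) (x : ℝ) :
    HasDerivAt (fun x : ℝ => |x| ^ p * x ^ 2 / (p + 2)) (|x| ^ p * x) x := by
  have h := (hasDerivAt_abs_rpow x (p := p + 2) (by linarith)).div_const (p + 2)
  have e : (fun x : ℝ => |x| ^ p * x ^ 2 / (p + 2)) = fun x : ℝ => |x| ^ (p + 2) / (p + 2) := by
    funext y
    rw [Real.rpow_add' (abs_nonneg y) (by linarith)]
    simp
  rw [e]
  refine h.congr_deriv ?_
  have : p + 2 ≠ 0 := by linarith
  rw [show p + 2 - 2 = p by ring]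
  field_simp

section
variable {N : ℕ} {lam : ℝ} {m : ℕ} {u u' u'' : ℝ → ℝ}

lemma aux_d1 (hu : BNSol N lam m u u' u'') {s : ℝ} (hs : s ∈ Ioo (0:ℝ) 1) :
    HasDerivAt u (u' s) s :=
  (hu.deriv_fst s (Ioo_subset_Icc_self hs)).hasDerivAt (Icc_mem_nhds hs.1 hs.2)

lemma aux_d2 (hu : BNSol N lam m u u' u'') {s : ℝ} (hs : s ∈ Ioo (0:ℝ) 1) :
    HasDerivAt u' (u'' s) s :=
  (hu.deriv_snd s (Ioo_subset_Icc_self hs)).hasDerivAt (Icc_mem_nhds hs.1 hs.2)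

lemma aux_c1 (hu : BNSol N lam m u u' u'') : ContinuousOn u (Icc 0 1) :=
  fun s hs => (hu.deriv_fst s hs).continuousWithinAt

lemma aux_c2 (hu : BNSol N lam m u u' u'') : ContinuousOn u' (Icc 0 1) :=
  fun s hs => (hu.deriv_snd s hs).continuousWithinAt

lemma aux_cG (hu : BNSol N lam m u u' u'') {p : ℝ} (hp : 0 < p) :
    ContinuousOn (fun s => |u s| ^ p * (u s) ^ 2 / (p + 2)) (Icc 0 1) := by
  have hG : Continuous (fun x : ℝ => |x| ^ p * x ^ 2 / (p + 2)) :=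
    continuous_iff_continuousAt.2 fun x => (aux_G p hp x).continuousAt
  exact hG.comp_continuousOn (aux_c1 hu)

end

lemma aux_lam (k : ℕ) (lam : ℝ) (m : ℕ) (u u' u'' : ℝ → ℝ) (hu : BNSol (k + 3) lam m u u' u'')
    (r : ℝ) (hr : IsFirstZero u r) : 0 ≤ lam := by
  by_contra hlam
  push Not at hlam
  obtain ⟨p, hp⟩ : ∃ p : ℝ, p = 4 / ((k:ℝ) + 1) := ⟨_, rfl⟩
  have hk : (0:ℝ) < (k:ℝ) + 1 := by positivity
  have hp0 : 0 < p := by rw [hp]; positivity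
  have hpk : p * ((k:ℝ) + 1) = 4 := by rw [hp]; field_simp
  set P : ℝ → ℝ := fun s => s ^ (k + 3) *
    ((u' s) ^ 2 / 2 + |u s| ^ p * (u s) ^ 2 / (p + 2) + lam * (u s) ^ 2 / 2)
    + ((k:ℝ) + 1) / 2 * (s ^ (k + 2) * (u s * u' s)) with hP
  have hder : ∀ s ∈ Ioo (0:ℝ) 1, HasDerivAt P (lam * s ^ (k + 2) * (u s) ^ 2) s := by
    intro s hs
    have h1 := aux_d1 hu hs
    have h2 := aux_d2 hu hs
    have hG := (aux_G p hp0 (u s)).comp s h1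
    have e1 := ((h2.pow 2).div_const 2).add hG |>.add (((h1.pow 2).const_mul lam).div_const 2)
    have e2 := ((hasDerivAt_pow (k + 3) s).mul e1).add
      (((hasDerivAt_pow (k + 2) s).mul (h1.mul h2)).const_mul (((k:ℝ) + 1) / 2))
    refine HasDerivAt.congr_deriv (f := P) e2 ?_
    have ode := hu.ode s hs
    have hs0 : s ≠ 0 := hs.1.ne'
    have ek : (((k + 3 : ℕ) : ℝ) - 2) = (k:ℝ) + 1 := by push_cast; ring
    rw [ek, ← hp] at ode
    have ode2 : s * u'' s + ((k:ℝ) + 2) * u' s + s * (|u s| ^ p * u s) + s * (lam * u s) = 0 := by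
      have : s * (u'' s + ((((k + 3 : ℕ) : ℝ) - 1) / s) * u' s + |u s| ^ p * u s + lam * u s) = 0 := by
        rw [ode, mul_zero]
      push_cast at this
      field_simp at this
      linear_combination this
    have hq : ((k:ℝ) + 3) / (p + 2) = ((k:ℝ) + 1) / 2 := by
      rw [div_eq_div_iff (by linarith) (by norm_num)]
      linear_combination - hpk
    simp only [Function.comp, Pi.add_apply, Pi.mul_apply, Pi.pow_apply, Nat.add_sub_cancel, show k + 3 - 1 = k + 2 from rfl,
      show k + 2 - 1 = k + 1 from rfl]
    push_cast
    simp only [Nat.add_sub_cancel, pow_one, show 2 - 1 = 1 from rfl]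
    linear_combination (s ^ (k + 2) * u' s + ((k:ℝ) + 1) / 2 * s ^ (k + 1) * u s) * ode2
      + s ^ (k + 2) * |u s| ^ p * u s ^ 2 * hq
  have hcont : ContinuousOn P (Icc 0 1) := by
    have c1 := aux_c1 hu
    have c2 := aux_c2 hu
    have c3 := aux_cG hu hp0
    refine ContinuousOn.add (ContinuousOn.mul (by fun_prop) (ContinuousOn.add (ContinuousOn.add
      (by fun_prop) c3) (by fun_prop))) (by fun_prop)
  have hanti : AntitoneOn P (Icc 0 1) := by
    apply antitoneOn_of_deriv_nonpos (convex_Icc 0 1) hcont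
    · rw [interior_Icc]
      exact fun s hs => (hder s hs).differentiableAt.differentiableWithinAt
    · rw [interior_Icc]
      intro s hs
      rw [(hder s hs).deriv]
      have : 0 < s ^ (k + 2) := pow_pos hs.1 _
      have h3 : 0 ≤ s ^ (k + 2) * (u s) ^ 2 := by positivity
      nlinarith
  have hP0 : P 0 = 0 := by simp [hP]
  have hP1 : 0 ≤ P 1 := by
    simp only [hP, hu.bc_one]
    simp
    positivity
  have hconst : ∀ s ∈ Icc (0:ℝ) 1, P s = 0 := by
    intro s hs
    have a := hanti (left_mem_Icc.2 zero_le_one) hs hs.1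
    have b := hanti hs (right_mem_Icc.2 zero_le_one) hs.2
    linarith
  have hr0 := hr.1.1
  have hr1 := hr.1.2
  have hsI : r / 2 ∈ Ioo (0:ℝ) 1 := ⟨by linarith, by linarith⟩
  have hne := hr.2.2 (r / 2) ⟨by linarith, by linarith⟩
  have hd := hder _ hsI
  have hz : HasDerivAt P 0 (r / 2) := by
    refine (hasDerivAt_const (r / 2) (0:ℝ)).congr_of_eventuallyEq ?_
    filter_upwards [Icc_mem_nhds hsI.1 hsI.2] with s hs using hconst s hs
  have := hd.unique hz
  have h5 : 0 < (r / 2) ^ (k + 2) := pow_pos hsI.1 _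
  have h6 : 0 < (u (r / 2)) ^ 2 := by positivity
  have h7 := mul_pos h5 h6
  nlinarith

lemma aux_sign {N : ℕ} {lam : ℝ} {m : ℕ} {u u' u'' : ℝ → ℝ} (hu : BNSol N lam m u u' u'')
    (r : ℝ) (hr : IsFirstZero u r) : u' r ≤ 0 := by
  obtain ⟨⟨hr0, hr1⟩, hur, hne⟩ := hr
  have hpos : ∀ s ∈ Ioo 0 r, 0 < u s := by
    intro s hs
    by_contra hcon
    push Not at hcon
    have hc : ContinuousOn u (Icc 0 s) :=
      (aux_c1 hu).mono (Icc_subset_Icc le_rfl (by linarith [hs.2]))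
    obtain ⟨t, ht, htu⟩ := intermediate_value_Icc' hs.1.le hc ⟨hcon, hu.pos_zero.le⟩
    have ht0 : t ≠ 0 := by
      rintro rfl
      exact hu.pos_zero.ne' htu
    exact hne t ⟨lt_of_le_of_ne ht.1 (Ne.symm ht0), lt_of_le_of_lt ht.2 hs.2⟩ htu
  have hd : HasDerivWithinAt u (u' r) (Ioo 0 r) r :=
    (hu.deriv_fst r ⟨hr0.le, hr1⟩).mono
      (fun s hs => ⟨hs.1.le, by linarith [hs.2]⟩)
  rw [hasDerivWithinAt_iff_tendsto_slope' (by simp)] at hd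
  haveI := right_nhdsWithin_Ioo_neBot hr0
  refine le_of_tendsto hd ?_
  filter_upwards [self_mem_nhdsWithin] with s hs
  rw [slope_def_field, hur]
  exact div_nonpos_of_nonneg_of_nonpos (by linarith [hpos s hs]) (by linarith [hs.2])

lemma aux_energy (k : ℕ) (lam : ℝ) (m : ℕ) (u u' u'' : ℝ → ℝ) (hu : BNSol (k + 3) lam m u u' u'')
    (hlam : 0 ≤ lam) (a s : ℝ) (ha : 0 ≤ a) (has : a ≤ s) (hs1 : s ≤ 1) (hua : u' a = 0) :
    |u s| ≤ |u a| := by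
  obtain ⟨p, hp⟩ : ∃ p : ℝ, p = 4 / ((k:ℝ) + 1) := ⟨_, rfl⟩
  have hk : (0:ℝ) < (k:ℝ) + 1 := by positivity
  have hp0 : 0 < p := by rw [hp]; positivity
  set E : ℝ → ℝ := fun s =>
    (u' s) ^ 2 / 2 + |u s| ^ p * (u s) ^ 2 / (p + 2) + lam * (u s) ^ 2 / 2 with hE
  have hder : ∀ s ∈ Ioo (0:ℝ) 1, HasDerivAt E (-(((k:ℝ) + 2) / s * (u' s) ^ 2)) s := by
    intro s hs
    have h1 := aux_d1 hu hs
    have h2 := aux_d2 hu hs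
    have hG := (aux_G p hp0 (u s)).comp s h1
    have e1 := ((h2.pow 2).div_const 2).add hG |>.add (((h1.pow 2).const_mul lam).div_const 2)
    refine HasDerivAt.congr_deriv (f := E) e1 ?_
    have ode := hu.ode s hs
    have ek : (((k + 3 : ℕ) : ℝ) - 2) = (k:ℝ) + 1 := by push_cast; ring
    have ek' : (((k + 3 : ℕ) : ℝ) - 1) = (k:ℝ) + 2 := by push_cast; ring
    rw [ek, ek', ← hp] at ode
    push_cast
    simp only [pow_one, show 2 - 1 = 1 from rfl]
    linear_combination u' s * ode
  have hcont : ContinuousOn E (Icc 0 1) := by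
    have c1 := aux_c1 hu
    have c2 := aux_c2 hu
    have c3 := aux_cG hu hp0
    exact ContinuousOn.add (ContinuousOn.add (by fun_prop) c3) (by fun_prop)
  have hanti : AntitoneOn E (Icc 0 1) := by
    apply antitoneOn_of_deriv_nonpos (convex_Icc 0 1) hcont
    · rw [interior_Icc]
      exact fun s hs => (hder s hs).differentiableAt.differentiableWithinAt
    · rw [interior_Icc]
      intro s hs
      rw [(hder s hs).deriv]
      have := hs.1
      have : 0 ≤ ((k:ℝ) + 2) / s * (u' s) ^ 2 := by positivity
      linarith
  have key := hanti ⟨ha, by linarith⟩ ⟨by linarith, hs1⟩ has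
  simp only [hE, hua] at key
  by_contra hcon
  push Not at hcon
  have h1 : |u a| ^ p < |u s| ^ p := Real.rpow_lt_rpow (abs_nonneg _) hcon hp0
  have h2 : (u a) ^ 2 < (u s) ^ 2 := sq_lt_sq.2 hcon
  have h3 : |u a| ^ p * (u a) ^ 2 < |u s| ^ p * (u s) ^ 2 :=
    mul_lt_mul'' h1 h2 (by positivity) (by positivity)
  have h4 : |u a| ^ p * (u a) ^ 2 / (p + 2) < |u s| ^ p * (u s) ^ 2 / (p + 2) :=
    div_lt_div_of_pos_right h3 (by linarith)
  have h5 := mul_le_mul_of_nonneg_left h2.le hlam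
  nlinarith [sq_nonneg (u' s)]

lemma aux_tangent (k : ℕ) (lam : ℝ) (m : ℕ) (u u' u'' : ℝ → ℝ) (hu : BNSol (k + 3) lam m u u' u'')
    (hlam : 0 ≤ lam) (r b : ℝ) (hr : 0 < r) (hb1 : b ≤ 1) (hur : u r = 0)
    (hur' : u' r ≤ 0) (hneg : ∀ s ∈ Icc r b, u s ≤ 0) :
    ∀ s ∈ Icc r b, |u s| ≤ -(1 / ((k:ℝ) + 1)) * r * u' r := by
  have hk : (0:ℝ) < (k:ℝ) + 1 := by positivity
  have hsub : Icc r b ⊆ Icc 0 1 := Icc_subset_Icc hr.le hb1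
  have hsub' : Ioo r b ⊆ Ioo 0 1 := Ioo_subset_Ioo hr.le hb1
  have c1 := (aux_c1 hu).mono hsub
  have c2 := (aux_c2 hu).mono hsub
  have hder : ∀ s ∈ Ioo r b, HasDerivAt (fun s => s ^ (k + 2) * u' s)
      (-(s ^ (k + 2) * ((|u s| ^ ((4:ℝ) / (((k + 3 : ℕ):ℝ) - 2)) + lam) * u s))) s := by
    intro s hs
    have h2 := aux_d2 hu (hsub' hs)
    refine ((hasDerivAt_pow (k + 2) s).mul h2).congr_deriv ?_
    have ode := hu.ode s (hsub' hs)
    have hs0 : s ≠ 0 := (hsub' hs).1.ne'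
    have ek' : (((k + 3 : ℕ) : ℝ) - 1) = (k:ℝ) + 2 := by push_cast; ring
    rw [ek'] at ode
    have e : s ^ (k + 2) * (((k:ℝ) + 2) / s) = ((k:ℝ) + 2) * s ^ (k + 1) := by
      field_simp
      ring
    simp only [show k + 2 - 1 = k + 1 from rfl]
    push_cast
    push_cast at ode
    linear_combination s ^ (k + 2) * ode - u' s * e
  have hmono : MonotoneOn (fun s => s ^ (k + 2) * u' s) (Icc r b) := by
    apply monotoneOn_of_deriv_nonneg (convex_Icc r b) (by fun_prop)
    · rw [interior_Icc]
      exact fun s hs => (hder s hs).differentiableAt.differentiableWithinAt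
    · rw [interior_Icc]
      intro s hs
      rw [(hder s hs).deriv]
      have h0 : 0 < s := (hsub' hs).1
      have h1 := hneg s (Ioo_subset_Icc_self hs)
      have h2 : 0 ≤ |u s| ^ ((4:ℝ) / (((k + 3 : ℕ):ℝ) - 2)) + lam := by positivity
      have h3 := mul_nonneg (pow_pos h0 (k + 2)).le (mul_nonneg h2 (neg_nonneg.2 h1))
      linarith
  set c := r ^ (k + 2) * u' r with hc
  have hder2 : ∀ s ∈ Ioo r b, HasDerivAt (fun s => u s + c / ((k:ℝ) + 1) * (s ^ (k + 1))⁻¹)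
      (u' s - c / s ^ (k + 2)) s := by
    intro s hs
    have h0 : 0 < s := (hsub' hs).1
    have h1 := aux_d1 hu (hsub' hs)
    refine (h1.add (((hasDerivAt_pow (k + 1) s).inv (pow_pos h0 _).ne').const_mul
      (c / ((k:ℝ) + 1)))).congr_deriv ?_
    simp only [Nat.add_sub_cancel]
    push_cast
    field_simp
    ring
  have hmono2 : MonotoneOn (fun s => u s + c / ((k:ℝ) + 1) * (s ^ (k + 1))⁻¹) (Icc r b) := by
    apply monotoneOn_of_deriv_nonneg (convex_Icc r b)
    · refine c1.add (continuousOn_const.mul (ContinuousOn.inv₀ (by fun_prop) ?_))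
      intro s hs
      exact (pow_pos (lt_of_lt_of_le hr hs.1) _).ne'
    · rw [interior_Icc]
      exact fun s hs => (hder2 s hs).differentiableAt.differentiableWithinAt
    · rw [interior_Icc]
      intro s hs
      rw [(hder2 s hs).deriv, sub_nonneg, div_le_iff₀ (pow_pos (hsub' hs).1 _)]
      have := hmono ⟨le_rfl, by linarith [hs.1, hs.2]⟩ (Ioo_subset_Icc_self hs) hs.1.le
      simp only at this
      linarith
  intro s hs
  have h := hmono2 ⟨le_rfl, hs.1.trans hs.2⟩ hs hs.1
  simp only [hur, zero_add] at h
  rw [abs_of_nonpos (hneg s hs)]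
  have e : c / ((k:ℝ) + 1) * (r ^ (k + 1))⁻¹ = 1 / ((k:ℝ) + 1) * r * u' r := by
    rw [hc]
    field_simp
    ring
  have hcn : c / ((k:ℝ) + 1) * (s ^ (k + 1))⁻¹ ≤ 0 := by
    have h0 : 0 < s := lt_of_lt_of_le hr hs.1
    refine mul_nonpos_of_nonpos_of_nonneg (div_nonpos_of_nonpos_of_nonneg ?_ hk.le) (by positivity)
    exact mul_nonpos_of_nonneg_of_nonpos (by positivity) hur'
  linarith

theorem statement6 (N : ℕ) (hN : 3 ≤ N) (lam : ℝ) (m : ℕ) (hm : 2 ≤ m)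
    (u u' u'' : ℝ → ℝ) (hu : BNSol N lam m u u' u'')
    (r : ℝ) (hr : IsFirstZero u r) :
    sSup ((fun s => |u s|) '' Set.Icc r 1) ≤ -(1 / ((N:ℝ) - 2)) * r * u' r := by
  obtain ⟨k, rfl⟩ : ∃ k, N = k + 3 := ⟨N - 3, by omega⟩
  have hlam := aux_lam k lam m u u' u'' hu r hr
  have hsign := aux_sign hu r hr
  obtain ⟨⟨hr0, hr1⟩, hur, -⟩ := hr
  have ek : (((k + 3 : ℕ) : ℝ) - 2) = (k:ℝ) + 1 := by push_cast; ring
  rw [ek]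
  have hsub : Icc r 1 ⊆ Icc 0 1 := Icc_subset_Icc hr0.le le_rfl
  have c1 := (aux_c1 hu).mono hsub
  have c2 := (aux_c2 hu).mono hsub
  apply csSup_le ((nonempty_Icc.2 hr1).image _)
  rintro _ ⟨s, hs, rfl⟩
  show |u s| ≤ _
  rcases eq_or_lt_of_le hr1 with h1 | hlt
  · refine aux_tangent k lam m u u' u'' hu hlam r 1 hr0 le_rfl hur hsign ?_ s hs
    intro t ht
    have : t = r := le_antisymm (by linarith [ht.2]) ht.1
    rw [this, hur]
  -- the first critical point after `r`
  obtain ⟨t0, ht0, ht0'⟩ := exists_hasDerivAt_eq_zero hlt c1 (by rw [hur, hu.bc_one])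
    (fun x hx => aux_d1 hu (Ioo_subset_Ioo hr0.le le_rfl hx))
  have hcl : IsCompact (Icc r 1 ∩ u' ⁻¹' {0}) :=
    isCompact_Icc.of_isClosed_subset (c2.preimage_isClosed_of_isClosed isClosed_Icc
      isClosed_singleton) inter_subset_left
  obtain ⟨b, ⟨hb, hb0⟩, hbl⟩ := hcl.exists_isLeast ⟨t0, Ioo_subset_Icc_self ht0, ht0'⟩
  have hb0 : u' b = 0 := hb0
  have hnp : ∀ t ∈ Ioo r b, u' t ≤ 0 := by
    intro t ht
    by_contra hcon
    push Not at hcon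
    obtain ⟨x, hx, hx0⟩ := intermediate_value_Icc ht.1.le
      (c2.mono (Icc_subset_Icc le_rfl (ht.2.le.trans hb.2))) ⟨hsign, hcon.le⟩
    have := hbl ⟨⟨hx.1, by linarith [hx.2, ht.2, hb.2]⟩, hx0⟩
    linarith [hx.2, ht.2]
  have hanti : AntitoneOn u (Icc r b) := by
    have hd : ∀ x ∈ Ioo r b, HasDerivAt u (u' x) x := fun x hx =>
      aux_d1 hu ⟨by linarith [hx.1], by linarith [hx.2, hb.2]⟩
    apply antitoneOn_of_deriv_nonpos (convex_Icc r b) (c1.mono (Icc_subset_Icc le_rfl hb.2))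
    · rw [interior_Icc]
      exact fun s hs => (hd s hs).differentiableAt.differentiableWithinAt
    · rw [interior_Icc]
      intro s hs
      rw [(hd s hs).deriv]
      exact hnp s hs
  have htan := aux_tangent k lam m u u' u'' hu hlam r b hr0 hb.2 hur hsign (by
    intro t ht
    have := hanti ⟨le_rfl, hb.1⟩ ht ht.1
    rwa [hur] at this)
  rcases le_total s b with h | h
  · exact htan s ⟨hs.1, h⟩
  · exact (aux_energy k lam m u u' u'' hu hlam b s (by linarith [hb.1]) h hs.2 hb0).trans
      (htan b ⟨hb.1, le_rfl⟩)
end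

section
/- Let N ∈ {3,4,5,6}, m ≥ 2, λ̄ > 0, and let (λ_n) → λ̄ and (u_n) be radial solutions of the Brezis–Nirenberg problem with m nodal zones for λ_n, with first zeros r_n, such that u_n(0) → ∞. Set M_n = sup_{r_n ≤ r ≤ 1} |u_n(r)|. Then M_n → 0 if N ∈ {3,4,5}, and (M_n) is bounded if N = 6. -/
open Real Set Filter Topology

/-- Monotonicity from a nonnegative derivative in the interior. -/
lemma le_of_derivs {f f' : ℝ → ℝ} {a b : ℝ} (hab : a ≤ b) (hc : ContinuousOn f (Icc a b))
    (hd : ∀ x ∈ Ioo a b, HasDerivAt f (f' x) x) (h0 : ∀ x ∈ Ioo a b, 0 ≤ f' x) : f a ≤ f b := by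
  have : MonotoneOn f (Icc a b) := by
    apply monotoneOn_of_deriv_nonneg (convex_Icc a b) hc
    · intro x hx
      rw [interior_Icc] at hx
      exact (hd x hx).differentiableAt.differentiableWithinAt
    · intro x hx
      rw [interior_Icc] at hx
      rw [(hd x hx).deriv]
      exact h0 x hx
  exact this (left_mem_Icc.2 hab) (right_mem_Icc.2 hab) hab

/-- Working hypotheses, with dimension `k + 2`, exponent `q = 4 / k`. -/
structure Work (k : ℕ) (q lam ρ : ℝ) (u u' u'' : ℝ → ℝ) : Prop where
  hk : 1 ≤ k
  hq : q * k = 4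
  hlam : 0 < lam
  rho0 : 0 < ρ
  rho1 : ρ ≤ 1
  cu : ContinuousOn u (Icc 0 1)
  cu' : ContinuousOn u' (Icc 0 1)
  d1 : ∀ r ∈ Ioo (0:ℝ) 1, HasDerivAt u (u' r) r
  d2 : ∀ r ∈ Ioo (0:ℝ) 1, HasDerivAt u' (u'' r) r
  ode : ∀ r ∈ Ioo (0:ℝ) 1, u'' r = -(((k:ℝ) + 1) / r * u' r) - |u r| ^ q * u r - lam * u r
  zrho : u ρ = 0
  zone : u 1 = 0
  pos : ∀ s ∈ Ico 0 ρ, 0 < u s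
  hA : 1 ≤ u 0
  hlA : lam ≤ u 0 ^ q

namespace Work

variable {k : ℕ} {q lam ρ : ℝ} {u u' u'' : ℝ → ℝ}

lemma qpos (h : Work k q lam ρ u u' u'') : 0 < q := by
  have h1 : (0:ℝ) < k := by exact_mod_cast h.hk
  have := h.hq
  by_contra hc
  push Not at hc
  nlinarith

lemma kpos (h : Work k q lam ρ u u' u'') : (1:ℝ) ≤ k := by exact_mod_cast h.hk

lemma dflux (h : Work k q lam ρ u u' u'') (r : ℝ) (hr : r ∈ Ioo (0:ℝ) 1) :
    HasDerivAt (fun r => r ^ (k+1) * u' r) (-(r ^ (k+1) * (|u r| ^ q * u r + lam * u r))) r := by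
  have h1 := (hasDerivAt_pow (k+1) r).mul (h.d2 r hr)
  refine h1.congr_deriv ?_
  rw [h.ode r hr]
  have : r ≠ 0 := hr.1.ne'
  simp only [Nat.add_sub_cancel]
  push_cast
  field_simp
  ring

lemma cflux (h : Work k q lam ρ u u' u'') : ContinuousOn (fun r => r ^ (k+1) * u' r) (Icc 0 1) :=
  (continuous_pow _).continuousOn.mul h.cu'

lemma flux_anti (h : Work k q lam ρ u u' u'') {a b : ℝ} (ha : 0 ≤ a) (hab : a ≤ b) (hb : b ≤ ρ) :
    b ^ (k+1) * u' b ≤ a ^ (k+1) * u' a := by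
  have hsub : Icc a b ⊆ Icc 0 1 := Icc_subset_Icc ha (hb.trans h.rho1)
  have := le_of_derivs (f := fun r => -(r ^ (k+1) * u' r)) hab (h.cflux.mono hsub).neg
    (fun x hx => (h.dflux x ⟨ha.trans_lt hx.1, hx.2.trans_le (hb.trans h.rho1)⟩).neg) ?_
  · linarith
  · intro x hx
    have hu := h.pos x ⟨ha.trans hx.1.le, hx.2.trans_le hb⟩
    have hx0 : 0 < x := ha.trans_lt hx.1
    have := h.hlam
    rw [neg_neg]
    positivity

lemma flux_nonpos (h : Work k q lam ρ u u' u'') {b : ℝ} (hb0 : 0 ≤ b) (hb : b ≤ ρ) :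
    b ^ (k+1) * u' b ≤ 0 := by
  have := h.flux_anti le_rfl hb0 hb
  simpa using this

lemma u'_nonpos (h : Work k q lam ρ u u' u'') {b : ℝ} (hb0 : 0 < b) (hb : b ≤ ρ) :
    u' b ≤ 0 := by
  have := h.flux_nonpos hb0.le hb
  have h2 : 0 < b ^ (k+1) := by positivity
  by_contra hc
  push Not at hc
  nlinarith [mul_pos h2 hc]

lemma u_anti (h : Work k q lam ρ u u' u'') {a b : ℝ} (ha : 0 ≤ a) (hab : a ≤ b) (hb : b ≤ ρ) :
    u b ≤ u a := by
  have hsub : Icc a b ⊆ Icc 0 1 := Icc_subset_Icc ha (hb.trans h.rho1)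
  have := le_of_derivs (f := fun r => -(u r)) hab (h.cu.mono hsub).neg
    (fun x hx => (h.d1 x ⟨ha.trans_lt hx.1, hx.2.trans_le (hb.trans h.rho1)⟩).neg) ?_
  · linarith
  · intro x hx
    have := h.u'_nonpos (ha.trans_lt hx.1) (hx.2.le.trans hb)
    linarith

/-- Lower bound for the flux in terms of a lower bound for `u`. -/
lemma flux_lower (h : Work k q lam ρ u u' u'') {b c : ℝ} (hb0 : 0 ≤ b) (hb : b ≤ ρ) (hc : 0 ≤ c)
    (hcu : ∀ s ∈ Ioo 0 b, c ≤ u s) :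
    b ^ (k+2) * (c ^ q * c) / (k+2) ≤ -(b ^ (k+1) * u' b) := by
  have hsub : Icc 0 b ⊆ Icc (0:ℝ) 1 := Icc_subset_Icc le_rfl (hb.trans h.rho1)
  have key := le_of_derivs (f := fun r => -(r ^ (k+1) * u' r) - r ^ (k+2) * ((c ^ q * c) / (k+2)))
    (f' := fun r => - -(r ^ (k+1) * (|u r| ^ q * u r + lam * u r)) - r ^ (k+1) * (c ^ q * c)) hb0
    (ContinuousOn.sub (h.cflux.mono hsub).neg (by fun_prop))
    (fun x hx => ?_) ?_
  · simp only [ne_eq, Nat.add_eq_zero_iff, one_ne_zero, and_false, not_false_eq_true, zero_pow,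
      zero_mul, neg_zero, sub_zero, OfNat.ofNat_ne_zero] at key
    rw [mul_div_assoc]
    linarith
  · refine ((h.dflux x ⟨hx.1, hx.2.trans_le (hb.trans h.rho1)⟩).neg.sub
      ((hasDerivAt_pow (k+2) x).mul_const _)).congr_deriv ?_
    have : ((k:ℝ)+2) ≠ 0 := by positivity
    simp only [Nat.add_succ_sub_one]
    push_cast
    field_simp
  · intro x hx
    have hu := h.pos x ⟨hx.1.le, hx.2.trans_le hb⟩
    have h1 := hcu x hx
    have h2 : c ^ q * c ≤ u x ^ q * u x :=
      mul_le_mul (rpow_le_rpow hc h1 h.qpos.le) h1 hc (by positivity)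
    rw [abs_of_pos hu]
    have h3 : 0 ≤ lam * u x := mul_nonneg h.hlam.le hu.le
    have h4 : 0 ≤ x ^ (k+1) := pow_nonneg hx.1.le _
    nlinarith [mul_nonneg h4 h3, mul_nonneg h4 (sub_nonneg.2 h2)]

lemma flux_upper (h : Work k q lam ρ u u' u'') {b : ℝ} (hb0 : 0 ≤ b) (hb : b ≤ ρ) :
     -(b ^ (k+1) * u' b) ≤ b ^ (k+2) * (2 * (u 0 ^ q * u 0)) / (k+2) := by
  have hsub : Icc 0 b ⊆ Icc (0:ℝ) 1 := Icc_subset_Icc le_rfl (hb.trans h.rho1)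
  have key := le_of_derivs
    (f := fun r => (r ^ (k+1) * u' r) + r ^ (k+2) * ((2 * (u 0 ^ q * u 0)) / (k+2)))
    (f' := fun r => -(r ^ (k+1) * (|u r| ^ q * u r + lam * u r)) + r ^ (k+1) * (2 * (u 0 ^ q * u 0)))
    hb0 (ContinuousOn.add (h.cflux.mono hsub) (by fun_prop))
    (fun x hx => ?_) ?_
  · simp only [ne_eq, Nat.add_eq_zero_iff, one_ne_zero, and_false, not_false_eq_true, zero_pow,
      zero_mul, add_zero, OfNat.ofNat_ne_zero] at key
    rw [mul_div_assoc]
    linarith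
  · refine ((h.dflux x ⟨hx.1, hx.2.trans_le (hb.trans h.rho1)⟩).add
      ((hasDerivAt_pow (k+2) x).mul_const _)).congr_deriv ?_
    have : ((k:ℝ)+2) ≠ 0 := by positivity
    simp only [Nat.add_succ_sub_one]
    push_cast
    field_simp
  · intro x hx
    have hu := h.pos x ⟨hx.1.le, hx.2.trans_le hb⟩
    have h1 := h.u_anti le_rfl hx.1.le (hx.2.le.trans hb)
    have hA := h.hA
    have h2 : u x ^ q * u x ≤ u 0 ^ q * u 0 :=
      mul_le_mul (rpow_le_rpow hu.le h1 h.qpos.le) h1 hu.le (by positivity)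
    have h3 : lam * u x ≤ u 0 ^ q * u 0 :=
      mul_le_mul h.hlA h1 hu.le (by positivity)
    rw [abs_of_pos hu]
    have h4 : 0 ≤ x ^ (k+1) := pow_nonneg hx.1.le _
    nlinarith [mul_nonneg h4 (sub_nonneg.2 h3), mul_nonneg h4 (sub_nonneg.2 h2)]

lemma u_lower (h : Work k q lam ρ u u' u'') {b : ℝ} (hb0 : 0 ≤ b) (hb : b ≤ ρ) :
     u 0 - b ^ 2 * (u 0 ^ q * u 0) / (k+2) ≤ u b := by
  have hsub : Icc 0 b ⊆ Icc (0:ℝ) 1 := Icc_subset_Icc le_rfl (hb.trans h.rho1)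
  have hk2 : (0:ℝ) < k + 2 := by positivity
  have key := le_of_derivs
    (f := fun r => u r + r ^ 2 * ((u 0 ^ q * u 0) / (k+2)))
    (f' := fun r => u' r + r * ((2 * (u 0 ^ q * u 0)) / (k+2)))
    hb0 (ContinuousOn.add (h.cu.mono hsub) (by fun_prop))
    (fun x hx => ?_) ?_
  · simp only [ne_eq, not_false_eq_true, zero_pow,
      zero_mul, add_zero, OfNat.ofNat_ne_zero] at key
    rw [mul_div_assoc]
    linarith
  · refine ((h.d1 x ⟨hx.1, hx.2.trans_le (hb.trans h.rho1)⟩).add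
      ((hasDerivAt_pow 2 x).mul_const _)).congr_deriv ?_
    simp
    ring
  · intro x hx
    have h1 := h.flux_upper hx.1.le (hx.2.le.trans hb)
    have h4 : 0 < x ^ (k+1) := pow_pos hx.1 _
    rw [mul_div_assoc, pow_succ x (k+1)] at h1
    by_contra hc
    push Not at hc
    nlinarith [mul_pos h4 (sub_pos.2 hc)]

/-- Lower bound for the flux at the first zero. -/
lemma flux_rho (h : Work k q lam ρ u u' u'') :
    (1/2) ^ q * (1/2) / (k+2) ≤ u 0 * -(ρ ^ (k+1) * u' ρ) := by
  have hA : 0 < u 0 := zero_lt_one.trans_le h.hA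
  have hk := h.kpos
  have hk2 : (0:ℝ) < k + 2 := by positivity
  set r0 : ℝ := u 0 ^ (-(q/2)) with hr0
  have hr0p : 0 < r0 := rpow_pos_of_pos hA _
  have e1 : r0 ^ 2 * u 0 ^ q = 1 := by
    rw [hr0, ← rpow_natCast, ← rpow_mul hA.le, ← rpow_add hA]
    norm_num
  have low : ∀ b, 0 ≤ b → b ≤ ρ → b ≤ r0 → u 0 / 2 ≤ u b := by
    intro b hb hbρ hbr
    refine le_trans ?_ (h.u_lower hb hbρ)
    have : b ^ 2 * (u 0 ^ q * u 0) ≤ u 0 := by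
      have : b ^ 2 ≤ r0 ^ 2 := pow_le_pow_left₀ hb hbr 2
      calc b ^ 2 * (u 0 ^ q * u 0) ≤ r0 ^ 2 * (u 0 ^ q * u 0) := by gcongr
        _ = u 0 := by rw [← mul_assoc, e1, one_mul]
    have h3 : b ^ 2 * (u 0 ^ q * u 0) / (k+2) ≤ u 0 / 2 :=
      (div_le_div_of_nonneg_right this hk2.le).trans
        (div_le_div_of_nonneg_left hA.le (by norm_num) (by linarith))
    linarith
  have hlt : r0 < ρ := by
    by_contra hc
    push Not at hc
    have := low ρ h.rho0.le le_rfl hc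
    rw [h.zrho] at this
    linarith
  have f1 := h.flux_lower hr0p.le hlt.le (c := u 0 / 2) (by positivity)
    (fun s hs => low s hs.1.le (hs.2.le.trans hlt.le) hs.2.le)
  have f2 := h.flux_anti hr0p.le hlt.le le_rfl
  have e2 : u 0 * (r0 ^ (k+2) * ((u 0 / 2) ^ q * (u 0 / 2)) / (k+2)) =
      (1/2) ^ q * (1/2) / (k+2) := by
    have e3 : u 0 * u 0 * r0 ^ k = 1 := by
      rw [hr0, ← rpow_natCast, ← rpow_mul hA.le]
      have : -(q/2) * k = -2 := by linarith [h.hq]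
      rw [this, rpow_neg hA.le]
      norm_num
      field_simp
    rw [show u 0 / 2 = u 0 * (1/2) by ring, mul_rpow hA.le (by norm_num), pow_add]
    calc _ = (u 0 * u 0 * r0 ^ k) * (r0 ^ 2 * u 0 ^ q) * ((1/2) ^ q * (1/2) / (k+2)) := by ring
      _ = _ := by rw [e3, e1]; ring
  rw [← e2]
  exact mul_le_mul_of_nonneg_left (by linarith) hA.le

/-- Pohozaev function. -/
noncomputable def P (k : ℕ) (q lam : ℝ) (u u' : ℝ → ℝ) (r : ℝ) : ℝ :=
  r ^ (k+2) * (u' r ^ 2 / 2 + |u r| ^ (q+2) / (q+2) + lam * u r ^ 2 / 2) + k/2 * (r ^ (k+1) * u' r * u r)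

lemma abs_split (h : Work k q lam ρ u u' u'') (x : ℝ) : |x| ^ (q+2) = |x| ^ q * x ^ 2 := by
  have hq := h.qpos
  rw [rpow_add' (abs_nonneg x) (by positivity)]
  norm_num

lemma dabs (h : Work k q lam ρ u u' u'') (r : ℝ) (hr : r ∈ Ioo (0:ℝ) 1) :
    HasDerivAt (fun r => |u r| ^ (q+2) / (q+2)) (|u r| ^ q * u r * u' r) r := by
  have hq := h.qpos
  have h1 := (((hasDerivAt_abs_rpow (u r) (show 1 < q + 2 by linarith)).comp r (h.d1 r hr))).div_const (q+2)
  refine h1.congr_deriv ?_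
  rw [show q + 2 - 2 = q by ring]
  field_simp

lemma cabs (h : Work k q lam ρ u u' u'') : ContinuousOn (fun r => |u r| ^ (q+2) / (q+2)) (Icc 0 1) := by
  have hq := h.qpos
  exact (h.cu.abs.rpow_const (fun x _ => Or.inr (by positivity))).div_const _

lemma dP (h : Work k q lam ρ u u' u'') (r : ℝ) (hr : r ∈ Ioo (0:ℝ) 1) :
    HasDerivAt (P k q lam u u') (lam * r ^ (k+1) * u r ^ 2) r := by
  have hq := h.qpos
  have h0 := h.d1 r hr
  have h1 := (((h.d2 r hr).pow 2).div_const 2).add (h.dabs r hr)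
  have h2 := h1.add (((h0.pow 2).const_mul lam).div_const 2)
  have h3 := ((hasDerivAt_pow (k+2) r).mul h2).add (((h.dflux r hr).mul h0).const_mul ((k:ℝ)/2))
  refine h3.congr_deriv ?_
  have hr0 : r ≠ 0 := hr.1.ne'
  simp only [Nat.add_succ_sub_one, Pi.add_apply, Pi.pow_apply]
  rw [h.ode r hr, h.abs_split]
  have e : (k:ℝ) = 4 / q := by rw [← h.hq]; field_simp
  push_cast
  rw [e]
  field_simp
  ring

lemma cP (h : Work k q lam ρ u u' u'') : ContinuousOn (P k q lam u u') (Icc 0 1) := by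
  unfold P
  have h1 := h.cu
  have h2 := h.cu'
  have h3 := h.cabs
  fun_prop

lemma P_zero : P k q lam u u' 0 = 0 := by simp [P]

lemma P_lower (h : Work k q lam ρ u u' u'') {b : ℝ} (hb0 : 0 ≤ b) (hb : b ≤ ρ) :
    lam * (b ^ (k+2) * u b ^ 2) / (k+2) ≤ P k q lam u u' b := by
  have hsub : Icc 0 b ⊆ Icc (0:ℝ) 1 := Icc_subset_Icc le_rfl (hb.trans h.rho1)
  have hk2 : (0:ℝ) < k + 2 := by positivity
  have key := le_of_derivs
    (f := fun r => P k q lam u u' r - lam * (r ^ (k+2) * u r ^ 2) / (k+2))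
    (f' := fun r => -(2 * lam * r ^ (k+2) * u r * u' r / (k+2)))
    hb0 ?_ (fun x hx => ?_) ?_
  · simp only [P_zero] at key
    simp at key
    exact key
  · have h1 := h.cu.mono hsub
    have h2 := h.cP.mono hsub
    fun_prop
  · have hx' : x ∈ Ioo (0:ℝ) 1 := ⟨hx.1, hx.2.trans_le (hb.trans h.rho1)⟩
    refine ((h.dP x hx').sub ((((hasDerivAt_pow (k+2) x).mul ((h.d1 x hx').pow 2)).const_mul
      lam).div_const ((k:ℝ)+2))).congr_deriv ?_
    simp only [Nat.add_succ_sub_one, Pi.pow_apply]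
    push_cast
    field_simp
    ring
  · intro x hx
    have hu := h.pos x ⟨hx.1.le, hx.2.trans_le hb⟩
    have hu' := h.u'_nonpos hx.1 (hx.2.le.trans hb)
    have hl := h.hlam
    have hx0 := hx.1
    have : 0 ≤ 2 * lam * x ^ (k+2) * u x * (- u' x) / (k+2) := by
      have : 0 ≤ - u' x := by linarith
      positivity
    calc 0 ≤ _ := this
      _ = _ := by ring

lemma dw (h : Work k q lam ρ u u' u'') (r : ℝ) (hr : r ∈ Ioo (0:ℝ) ρ) :
    HasDerivAt (fun r => -(u r ^ (-(q/2) - 1) * u' r / r))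
      (u r ^ (-(q/2) - 2) * (r ^ (k+3))⁻¹ *
        ((q/2+1) * 2 * P k q lam u u' r - q * lam * (r ^ (k+2) * u r ^ 2)/2)) r := by
  have hr' : r ∈ Ioo (0:ℝ) 1 := ⟨hr.1, hr.2.trans_le h.rho1⟩
  have hu := h.pos r ⟨hr.1.le, hr.2⟩
  have hq := h.qpos
  have hr0 : r ≠ 0 := hr.1.ne'
  have h1 := (((h.d1 r hr').rpow_const (p := -(q/2) - 1) (Or.inl hu.ne')).mul (h.d2 r hr')).div
    (hasDerivAt_id r) hr0 |>.neg
  refine h1.congr_deriv ?_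
  simp only [P, id, Pi.mul_apply]
  rw [h.ode r hr', h.abs_split]
  have e : (k:ℝ) = 4 / q := by rw [← h.hq]; field_simp
  rw [show -(q/2) - 1 = (-(q/2) - 2) + 1 by ring, rpow_add hu, rpow_one,
    show -(q/2) - 2 + 1 - 1 = -(q/2) - 2 by ring, e]
  generalize u r ^ (-(q/2) - 2) = T
  simp only [pow_succ]
  field_simp
  ring

lemma w_mono (h : Work k q lam ρ u u' u'') {a b : ℝ} (ha : 0 < a) (hab : a ≤ b) (hb : b < ρ) :
    -(u a ^ (-(q/2) - 1) * u' a / a) ≤ -(u b ^ (-(q/2) - 1) * u' b / b) := by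
  refine le_of_derivs (f := fun r => -(u r ^ (-(q/2) - 1) * u' r / r)) hab
    (fun x hx => (h.dw x ⟨ha.trans_le hx.1, hx.2.trans_lt hb⟩).continuousAt.continuousWithinAt)
    (fun x hx => h.dw x ⟨ha.trans hx.1, hx.2.trans hb⟩) ?_
  intro x hx
  have hx0 := ha.trans hx.1
  have hu := h.pos x ⟨hx0.le, hx.2.trans hb⟩
  have hp := h.P_lower hx0.le (hx.2.trans hb).le
  have hq := h.qpos
  refine mul_nonneg (by positivity) ?_
  have hk2 : (0:ℝ) < k + 2 := by positivity
  rw [div_le_iff₀ hk2] at hp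
  have e : (k:ℝ) = 4 / q := by rw [← h.hq]; field_simp
  have e2 : (q/2+1) * 2 = q / 2 * ((k:ℝ) + 2) := by rw [e]; field_simp; ring
  rw [e2]
  nlinarith

lemma w_lower (h : Work k q lam ρ u u' u'') {b : ℝ} (hb0 : 0 < b) (hb : b < ρ) :
    u 0 ^ (q/2) / (k+2) ≤ -(u b ^ (-(q/2) - 1) * u' b / b) := by
  have hq := h.qpos
  have hlim : Tendsto (fun s => u s ^ (q/2) / ((k:ℝ)+2)) (𝓝[>] 0) (𝓝 (u 0 ^ (q/2) / (k+2))) := by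
    have h1 : Tendsto u (𝓝[>] 0) (𝓝 (u 0)) :=
      ((h.cu 0 (by simp)).mono_of_mem_nhdsWithin
        (mem_of_superset (Ioo_mem_nhdsGT (zero_lt_one (α := ℝ))) Ioo_subset_Icc_self)).tendsto
    exact (h1.rpow_const (Or.inr (by positivity))).div_const _
  refine le_of_tendsto hlim ?_
  filter_upwards [Ioo_mem_nhdsGT hb0] with s hs
  refine le_trans ?_ (h.w_mono hs.1 hs.2.le hb)
  have hs' := hs.2.trans hb
  have hu := h.pos s ⟨hs.1.le, hs'⟩
  have hs0 := hs.1
  have f := h.flux_lower hs.1.le hs'.le hu.le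
    (fun x hx => h.u_anti hx.1.le hx.2.le hs'.le)
  have e : u s ^ (q/2) / ((k:ℝ)+2) = (s ^ (k+2) * (u s ^ q * u s) / (k+2)) * (u s ^ (-(q/2) - 1) / s ^ (k+2)) := by
    have : u s ^ (q/2) = u s ^ q * u s * u s ^ (-(q/2) - 1) := by
      nth_rewrite 3 [← rpow_one (u s)]
      rw [← rpow_add hu, ← rpow_add hu]
      ring_nf
    rw [this]
    field_simp
  rw [e]
  refine (mul_le_mul_of_nonneg_right f (by positivity)).trans_eq ?_
  rw [pow_succ s (k+1)]
  field_simp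

lemma v_lower (h : Work k q lam ρ u u' u'') {b : ℝ} (hb0 : 0 ≤ b) (hb : b < ρ) :
    q / 4 / (k+2) * u 0 ^ (q/2) * b ^ 2 ≤ u b ^ (-(q/2)) := by
  have hsub : Icc 0 b ⊆ Icc (0:ℝ) 1 := Icc_subset_Icc le_rfl (hb.le.trans h.rho1)
  have hq := h.qpos
  have hA : 0 < u 0 := zero_lt_one.trans_le h.hA
  have key := le_of_derivs
    (f := fun r => u r ^ (-(q/2)) - q / 4 / (k+2) * u 0 ^ (q/2) * r ^ 2)
    (f' := fun r => q / 2 * r * (-(u r ^ (-(q/2) - 1) * u' r / r) - u 0 ^ (q/2) / (k+2)))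
    hb0 ?_ (fun x hx => ?_) ?_
  · simp only [ne_eq, OfNat.ofNat_ne_zero, not_false_eq_true, zero_pow, mul_zero, sub_zero] at key
    have : 0 ≤ u 0 ^ (-(q/2)) := by positivity
    linarith
  · refine ContinuousOn.sub ((h.cu.mono hsub).rpow_const (fun x hx => Or.inl ?_)) (by fun_prop)
    exact (h.pos x ⟨hx.1, hx.2.trans_lt hb⟩).ne'
  · have hx' : x ∈ Ioo (0:ℝ) 1 := ⟨hx.1, hx.2.trans (hb.trans_le h.rho1)⟩
    have hu := h.pos x ⟨hx.1.le, hx.2.trans hb⟩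
    have hx0 : x ≠ 0 := hx.1.ne'
    refine (((h.d1 x hx').rpow_const (p := -(q/2)) (Or.inl hu.ne')).sub
      ((hasDerivAt_pow 2 x).const_mul _)).congr_deriv ?_
    field_simp
    norm_num
    ring
  · intro x hx
    have := h.w_lower hx.1 (hx.2.trans hb)
    have hx0 := hx.1
    exact mul_nonneg (by positivity) (by linarith)

/-- The bubble upper bound. -/
lemma bubble (h : Work k q lam ρ u u' u'') {b : ℝ} (hb0 : 0 < b) (hb : b < ρ) :
    u 0 * b ^ k * u b ≤ (q / 4 / (k+2)) ^ (-(k/2:ℝ)) := by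
  have hq := h.qpos
  have hA : 0 < u 0 := zero_lt_one.trans_le h.hA
  have hu := h.pos b ⟨hb0.le, hb⟩
  have hv := h.v_lower hb0.le hb
  have hk := h.kpos
  set c : ℝ := q / 4 / (k+2) with hc
  have hc0 : 0 < c := by positivity
  have h1 := rpow_le_rpow (by positivity) hv (show (0:ℝ) ≤ k/2 by positivity)
  rw [← rpow_mul hu.le, mul_rpow (by positivity) (by positivity), mul_rpow hc0.le (by positivity),
    ← rpow_mul hA.le, show q/2 * ((k:ℝ)/2) = 1 by linarith [h.hq],
    show -(q/2) * ((k:ℝ)/2) = -1 by linarith [h.hq], rpow_one, rpow_neg_one] at h1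
  have e : (b^2) ^ ((k:ℝ)/2) = b ^ k := by
    rw [← rpow_natCast b 2, ← rpow_mul hb0.le, ← rpow_natCast b k]
    congr 1
    push_cast
    ring
  rw [e] at h1
  rw [rpow_neg hc0.le]
  have hck : 0 < c ^ ((k:ℝ)/2) := by positivity
  rw [← one_div, le_div_iff₀ hu] at h1
  rw [← one_div, le_div_iff₀ hck]
  linarith

lemma P_upper_low (h : Work k q lam ρ u u' u'') (hk3 : k ≤ 3) :
    P k q lam u u' ρ ≤ lam * (5 * ((q / 4 / (k+2)) ^ (-(k/2:ℝ))) ^ (8/5:ℝ)) * u 0 ^ (-(6/5):ℝ) := by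
  have hq := h.qpos
  have hl := h.hlam
  have hA : 0 < u 0 := zero_lt_one.trans_le h.hA
  have hk3' : (k:ℝ) ≤ 3 := by exact_mod_cast hk3
  have hsub : Icc 0 ρ ⊆ Icc (0:ℝ) 1 := Icc_subset_Icc le_rfl h.rho1
  have hbub := fun (b : ℝ) => h.bubble (b := b)
  have hC : 0 < (q / 4 / ((k:ℝ)+2)) ^ (-(k/2:ℝ)) := by positivity
  generalize (q / 4 / ((k:ℝ)+2)) ^ (-(k/2:ℝ)) = C at hbub hC ⊢
  set e : ℝ := 2 - 3 * k / 5 with he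
  have he0 : 1/5 ≤ e := by rw [he]; linarith
  have key := le_of_derivs
    (f := fun r => lam * C ^ (8/5:ℝ) * u 0 ^ (-(6/5):ℝ) / e * r ^ e - P k q lam u u' r)
    (f' := fun r => lam * C ^ (8/5:ℝ) * u 0 ^ (-(6/5):ℝ) * r ^ (e-1) - lam * r ^ (k+1) * u r ^ 2)
    h.rho0.le ?_ (fun x hx => ?_) ?_
  · simp only [P_zero] at key
    rw [zero_rpow (by linarith)] at key
    have h1 : ρ ^ e ≤ 1 := rpow_le_one h.rho0.le h.rho1 (by linarith)
    have h2 : lam * C ^ (8/5:ℝ) * u 0 ^ (-(6/5):ℝ) / e ≤ lam * C ^ (8/5:ℝ) * u 0 ^ (-(6/5):ℝ) * 5 := by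
      rw [div_eq_mul_inv]
      gcongr
      rw [inv_le_comm₀ (by linarith) (by norm_num)]
      linarith
    have h3 : lam * C ^ (8/5:ℝ) * u 0 ^ (-(6/5):ℝ) / e * ρ ^ e ≤ 
        lam * C ^ (8/5:ℝ) * u 0 ^ (-(6/5):ℝ) / e * 1 := by
      gcongr
    linarith
  · refine ContinuousOn.sub (continuousOn_const.mul (continuousOn_id.rpow_const
      (fun x _ => Or.inr (by linarith)))) (h.cP.mono hsub)
  · refine (((hasDerivAt_rpow_const (p := e) (Or.inl hx.1.ne')).const_mul _).sub
      (h.dP x ⟨hx.1, hx.2.trans_le h.rho1⟩)).congr_deriv ?_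
    have : e ≠ 0 := by linarith
    field_simp
  · intro x hx
    have hu := h.pos x ⟨hx.1.le, hx.2⟩
    have hx0 := hx.1
    have hb := hbub x hx.1 hx.2
    have huA := h.u_anti le_rfl hx.1.le hx.2.le
    have e1 : x ^ (k+1) * u x ^ 2 =
        (u 0 * x ^ k * u x) ^ (8/5:ℝ) * (u x ^ (2/5:ℝ) * u 0 ^ (-(8/5):ℝ)) * x ^ (e-1) := by
      rw [mul_rpow (by positivity) hu.le, mul_rpow hA.le (by positivity), ← rpow_natCast x k,
        ← rpow_mul hx0.le]
      have a1 : u 0 ^ (8/5:ℝ) * u 0 ^ (-(8/5):ℝ) = 1 := by rw [← rpow_add hA]; norm_num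
      have a2 : u x ^ (8/5:ℝ) * u x ^ (2/5:ℝ) = u x ^ 2 := by rw [← rpow_add hu]; norm_num
      have a3 : x ^ ((k:ℝ) * (8/5)) * x ^ (e-1) = x ^ (k+1) := by
        rw [← rpow_add hx0, ← rpow_natCast x (k+1)]
        congr 1
        rw [he]; push_cast; ring
      rw [← a2, ← a3]
      linear_combination (-(u x ^ (8/5:ℝ) * u x ^ (2/5:ℝ) * (x ^ ((k:ℝ) * (8/5)) * x ^ (e-1)))) * a1
    have e2 : u x ^ (2/5:ℝ) * u 0 ^ (-(8/5):ℝ) ≤ u 0 ^ (-(6/5):ℝ) := by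
      calc _ ≤ u 0 ^ (2/5:ℝ) * u 0 ^ (-(8/5):ℝ) := by gcongr
        _ = _ := by rw [← rpow_add hA]; norm_num
    have e3 : x ^ (k+1) * u x ^ 2 ≤ C ^ (8/5:ℝ) * u 0 ^ (-(6/5):ℝ) * x ^ (e-1) := by
      rw [e1]
      gcongr
    have := mul_le_mul_of_nonneg_left e3 hl.le
    linarith

lemma P_upper_six (h : Work k q lam ρ u u' u'') (hk4 : k = 4) :
    P k q lam u u' ρ * u 0 ≤ lam * (12 * (q / 4 / (k+2)) ^ (-(k/2:ℝ))) := by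
  have hq := h.qpos
  have hl := h.hlam
  have hA : 0 < u 0 := zero_lt_one.trans_le h.hA
  have hk4' : (k:ℝ) = 4 := by exact_mod_cast hk4
  have hq1 : q = 1 := by have := h.hq; rw [hk4'] at this; linarith
  have hsub : Icc 0 ρ ⊆ Icc (0:ℝ) 1 := Icc_subset_Icc le_rfl h.rho1
  have hbub := fun (b : ℝ) => h.bubble (b := b)
  have hC : 0 < (q / 4 / ((k:ℝ)+2)) ^ (-(k/2:ℝ)) := by positivity
  generalize (q / 4 / ((k:ℝ)+2)) ^ (-(k/2:ℝ)) = C at hbub hC ⊢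
  have key := le_of_derivs
    (f := fun r => -(12 * lam * C * u 0 ^ (-(3/2):ℝ)) * u r ^ (1/2:ℝ) - P k q lam u u' r)
    (f' := fun r => -(12 * lam * C * u 0 ^ (-(3/2):ℝ)) * (u' r * (1/2) * u r ^ (1/2-1:ℝ))
      - lam * r ^ (k+1) * u r ^ 2)
    h.rho0.le ?_ (fun x hx => ?_) ?_
  · simp only [P_zero, h.zrho] at key
    rw [zero_rpow (by norm_num)] at key
    have a : u 0 ^ (-(3/2):ℝ) * u 0 ^ (1/2:ℝ) = (u 0)⁻¹ := by
      rw [← rpow_add hA, ← rpow_neg_one]; norm_num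
    rw [← le_div_iff₀ hA, div_eq_mul_inv, ← a]
    linarith
  · refine ContinuousOn.sub (continuousOn_const.mul ((h.cu.mono hsub).rpow_const
      (fun x _ => Or.inr (by norm_num)))) (h.cP.mono hsub)
  · have hu := h.pos x ⟨hx.1.le, hx.2⟩
    have hx' : x ∈ Ioo (0:ℝ) 1 := ⟨hx.1, hx.2.trans_le h.rho1⟩
    exact ((((h.d1 x hx').rpow_const (Or.inl hu.ne')).const_mul _).sub (h.dP x hx'))
  · intro x hx
    have hu := h.pos x ⟨hx.1.le, hx.2⟩
    have hx0 := hx.1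
    have hb := hbub x hx.1 hx.2
    have hw := h.w_lower hx.1 hx.2
    rw [hq1, hk4', neg_div', le_div_iff₀ hx0, show -(1/2:ℝ) - 1 = (1/2 - 1) - 1 by norm_num,
      rpow_sub_one hu.ne'] at hw
    have a : u 0 ^ (-(3/2):ℝ) * u 0 ^ (1/2:ℝ) = (u 0)⁻¹ := by
      rw [← rpow_add hA, ← rpow_neg_one]; norm_num
    have hw2 : u 0 ^ (1/2:ℝ) * x * u x ≤ -6 * (u x ^ (1/2 - 1:ℝ) * u' x) := by
      have := mul_le_mul_of_nonneg_right hw (mul_nonneg hu.le (by norm_num : (0:ℝ) ≤ 6))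
      have e : -(u x ^ (1/2 - 1:ℝ) / u x * u' x) * (u x * 6) = -6 * (u x ^ (1/2 - 1:ℝ) * u' x) := by
        field_simp
      rw [e] at this
      calc _ = u 0 ^ (1/2:ℝ) / (4+2) * x * (u x * 6) := by ring
        _ ≤ _ := this
    have h2 : x ^ (k+1) * u x ^ 2 ≤ C * (u 0)⁻¹ * (x * u x) := by
      have : x ^ (k+1) * u x ^ 2 = (u 0 * x ^ k * u x) * ((u 0)⁻¹ * (x * u x)) := by
        field_simp
        ring
      rw [this, mul_assoc C]
      gcongr
    have h3 : C * (u 0)⁻¹ * (x * u x) ≤ C * u 0 ^ (-(3/2):ℝ) * (-6 * (u x ^ (1/2 - 1:ℝ) * u' x)) := by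
      rw [← a]
      calc _ = C * u 0 ^ (-(3/2):ℝ) * (u 0 ^ (1/2:ℝ) * x * u x) := by ring
        _ ≤ _ := by gcongr
    have := mul_le_mul_of_nonneg_left (h2.trans h3) hl.le
    linarith

lemma energy_anti (h : Work k q lam ρ u u' u'') {a b : ℝ} (ha : 0 < a) (hab : a ≤ b) (hb : b ≤ 1) :
    u' b ^ 2 / 2 + |u b| ^ (q+2) / (q+2) + lam * u b ^ 2 / 2 ≤
      u' a ^ 2 / 2 + |u a| ^ (q+2) / (q+2) + lam * u a ^ 2 / 2 := by
  have hsub : Icc a b ⊆ Icc 0 1 := Icc_subset_Icc ha.le hb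
  have key := le_of_derivs
    (f := fun r => -(u' r ^ 2 / 2 + |u r| ^ (q+2) / (q+2) + lam * u r ^ 2 / 2))
    (f' := fun r => (k+1) / r * u' r ^ 2) hab ?_ (fun r hx => ?_) ?_
  · linarith
  · have h1 := h.cu.mono hsub
    have h2 := h.cu'.mono hsub
    have h3 := h.cabs.mono hsub
    fun_prop
  · have hr : r ∈ Ioo (0:ℝ) 1 := ⟨ha.trans hx.1, hx.2.trans_le hb⟩
    have h1 := (((h.d2 r hr).pow 2).div_const 2).add (h.dabs r hr)
    have h2 := h1.add ((((h.d1 r hr).pow 2).const_mul lam).div_const 2)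
    refine h2.neg.congr_deriv ?_
    rw [h.ode r hr]
    ring
  · intro x hx
    have := ha.trans hx.1
    positivity

/-- Bound beyond the first zero by the flux there. -/
lemma outer (h : Work k q lam ρ u u' u'') (hF : 0 < -(ρ ^ (k+1) * u' ρ)) {s : ℝ}
    (hs : s ∈ Icc ρ 1) : |u s| ≤ -(ρ ^ (k+1) * u' ρ) / k / ρ ^ k := by
  have hρ := h.rho0
  have hk := h.kpos
  have hq := h.qpos
  set F := -(ρ ^ (k+1) * u' ρ) with hFdef
  have hB : 0 ≤ F / k / ρ ^ k := by positivity
  rcases h.rho1.eq_or_lt with h1 | h1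
  · have : s = 1 := le_antisymm hs.2 (h1 ▸ hs.1)
    rw [this, h.zone, abs_zero]
    exact hB
  have hu'ρ : u' ρ < 0 := by
    have : 0 < ρ ^ (k+1) := by positivity
    by_contra hc
    push Not at hc
    nlinarith [mul_nonneg this.le hc]
  -- first critical point
  obtain ⟨c, hc, hc0⟩ := exists_hasDerivAt_eq_zero (f := u) (f' := u') h1
    (h.cu.mono (Icc_subset_Icc hρ.le le_rfl)) (by rw [h.zrho, h.zone])
    (fun x hx => h.d1 x ⟨hρ.trans hx.1, hx.2⟩)
  have hcomp : IsCompact (Icc ρ 1 ∩ u' ⁻¹' {0}) :=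
    isCompact_Icc.of_isClosed_subset
      ((h.cu'.mono (Icc_subset_Icc hρ.le le_rfl)).preimage_isClosed_of_isClosed isClosed_Icc
        isClosed_singleton) inter_subset_left
  obtain ⟨t, ⟨ht, ht0⟩, htm⟩ := hcomp.exists_isLeast ⟨c, Ioo_subset_Icc_self hc, hc0⟩
  have ht0 : u' t = 0 := ht0
  have hneg : ∀ x ∈ Icc ρ 1, x < t → u' x < 0 := by
    intro x hx hxt
    by_contra hcon
    push Not at hcon
    have hi := intermediate_value_Icc hx.1
      (h.cu'.mono (Icc_subset_Icc hρ.le hx.2)) (show (0:ℝ) ∈ Icc (u' ρ) (u' x) from ⟨hu'ρ.le, hcon⟩)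
    obtain ⟨y, hy, hy0⟩ := hi
    have := htm ⟨⟨hy.1, hy.2.trans hx.2⟩, hy0⟩
    linarith [hy.2]
  have hun : ∀ x ∈ Icc ρ t, u x ≤ 0 := by
    intro x hx
    have := le_of_derivs (f := fun r => -(u r)) hx.1
      (h.cu.mono (Icc_subset_Icc hρ.le (hx.2.trans ht.2))).neg
      (fun y hy => (h.d1 y ⟨hρ.trans hy.1, hy.2.trans_le (hx.2.trans ht.2)⟩).neg) ?_
    · simp only [h.zrho] at this; linarith
    · intro y hy
      have := hneg y ⟨hy.1.le, (hy.2.trans_le (hx.2.trans ht.2)).le⟩ (hy.2.trans_le hx.2)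
      linarith
  have hfl : ∀ x ∈ Icc ρ t, -F ≤ x ^ (k+1) * u' x := by
    intro x hx
    have := le_of_derivs (f := fun r => r ^ (k+1) * u' r) hx.1
      (h.cflux.mono (Icc_subset_Icc hρ.le (hx.2.trans ht.2)))
      (fun y hy => (h.dflux y ⟨hρ.trans hy.1, hy.2.trans_le (hx.2.trans ht.2)⟩)) ?_
    · rw [hFdef, neg_neg]; exact this
    · intro y hy
      have h2 := hun y ⟨hy.1.le, (hy.2.trans_le hx.2).le⟩
      have hy0 : 0 < y := hρ.trans hy.1
      have hl := h.hlam
      have : 0 ≤ y ^ (k+1) * (|u y| ^ q * (-u y) + lam * (-u y)) := by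
        have : 0 ≤ - u y := by linarith
        positivity
      linarith
  have hin : ∀ x ∈ Icc ρ t, |u x| ≤ F / k / ρ ^ k := by
    intro x hx
    have hx0 : 0 < x := hρ.trans_le hx.1
    rw [abs_of_nonpos (hun x hx)]
    have := le_of_derivs (f := fun r => u r - F / k * (r ^ k)⁻¹)
      (f' := fun r => u' r + F / r ^ (k+1)) hx.1 ?_ (fun y hy => ?_) ?_
    · simp only [h.zrho] at this
      have h3 : 0 ≤ F / k * (x ^ k)⁻¹ := by positivity
      rw [div_eq_mul_inv (F / k)]
      linarith
    · refine (h.cu.mono (Icc_subset_Icc hρ.le (hx.2.trans ht.2))).sub (continuousOn_const.mul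
        ((continuous_pow k).continuousOn.inv₀ (fun y hy => ?_)))
      exact (pow_pos (hρ.trans_le hy.1) k).ne'
    · have hy0 : 0 < y := hρ.trans hy.1
      refine ((h.d1 y ⟨hρ.trans hy.1, hy.2.trans_le (hx.2.trans ht.2)⟩).sub
        (((hasDerivAt_pow k y).inv (pow_pos hy0 k).ne').const_mul _)).congr_deriv ?_
      obtain ⟨j, rfl⟩ : ∃ j, k = j + 1 := ⟨k - 1, by have := h.hk; omega⟩
      simp only [Nat.add_sub_cancel]
      have : ((j + 1 : ℕ) : ℝ) ≠ 0 := by positivity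
      field_simp
      ring
    · intro y hy
      have h2 := hfl y ⟨hy.1.le, (hy.2.trans_le hx.2).le⟩
      have hy0 : 0 < y ^ (k+1) := pow_pos (hρ.trans hy.1) _
      have : -F / y ^ (k+1) ≤ u' y := by
        rw [div_le_iff₀ hy0]; linarith
      rw [neg_div] at this
      linarith
  rcases le_total s t with hst | hst
  · exact hin s ⟨hs.1, hst⟩
  · refine le_trans ?_ (hin t ⟨ht.1, le_rfl⟩)
    have hE := h.energy_anti (hρ.trans_le ht.1) hst hs.2
    rw [ht0] at hE
    by_contra hcon
    push Not at hcon
    have g1 : |u t| ^ (q+2) / (q+2) ≤ |u s| ^ (q+2) / (q+2) := by gcongr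
    have g2 : u t ^ 2 < u s ^ 2 := sq_lt_sq.2 hcon
    nlinarith [h.hlam, sq_nonneg (u' s), mul_pos h.hlam (sub_pos.2 g2)]

lemma outer_P (h : Work k q lam ρ u u' u'') {s : ℝ} (hs : s ∈ Icc ρ 1) :
    |u s| ≤ 2 / k / ((1/2) ^ q * (1/2) / (k+2)) * (P k q lam u u' ρ * u 0) := by
  have hρ := h.rho0
  have hk := h.kpos
  have hq := h.qpos
  have hA : 0 < u 0 := zero_lt_one.trans_le h.hA
  have hf := h.flux_rho
  set c : ℝ := (1/2) ^ q * (1/2) / (k+2) with hc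
  have hc0 : 0 < c := by positivity
  have hF : 0 < -(ρ ^ (k+1) * u' ρ) := by
    by_contra hcon
    push Not at hcon
    nlinarith
  have ho := h.outer hF hs
  have hP : P k q lam u u' ρ = (-(ρ ^ (k+1) * u' ρ)) ^ 2 / ρ ^ k / 2 := by
    simp only [P, h.zrho, abs_zero]
    rw [zero_rpow (by positivity)]
    field_simp
    ring
  rw [hP]
  generalize -(ρ ^ (k+1) * u' ρ) = F at *
  refine ho.trans ?_
  have : 2 / k / c * (F ^ 2 / ρ ^ k / 2 * u 0) = F / k / ρ ^ k * (u 0 * F / c) := by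
    field_simp
  rw [this]
  have h1 : 1 ≤ u 0 * F / c := by rwa [le_div_iff₀ hc0, one_mul]
  exact le_mul_of_one_le_right (by positivity) h1

end Work

/-- From a solution to the working hypotheses. -/
lemma BNSol.work {k m : ℕ} {lam ρ : ℝ} {u u' u'' : ℝ → ℝ} (hk : 1 ≤ k) (h : BNSol (k+2) lam m u u' u'')
    (hz : IsFirstZero u ρ) (hl : 0 < lam) (hA : 1 ≤ u 0) (hlA : lam ≤ u 0 ^ (4 / (k:ℝ))) :
    Work k (4 / (k:ℝ)) lam ρ u u' u'' := by
  have hk0 : (0:ℝ) < k := by exact_mod_cast hk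
  have cu : ContinuousOn u (Icc 0 1) := fun r hr => (h.deriv_fst r hr).continuousWithinAt
  refine ⟨hk, by field_simp, hl, hz.1.1, hz.1.2, cu,
    fun r hr => (h.deriv_snd r hr).continuousWithinAt,
    fun r hr => (h.deriv_fst r (Ioo_subset_Icc_self hr)).hasDerivAt (Icc_mem_nhds hr.1 hr.2),
    fun r hr => (h.deriv_snd r (Ioo_subset_Icc_self hr)).hasDerivAt (Icc_mem_nhds hr.1 hr.2),
    fun r hr => ?_, hz.2.1, h.bc_one, fun s hs => ?_, hA, hlA⟩
  · have := h.ode r hr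
    push_cast at this
    rw [show (k:ℝ) + 2 - 2 = k by ring, show (k:ℝ) + 2 - 1 = k + 1 by ring] at this
    linarith
  · by_contra hc
    push Not at hc
    obtain ⟨y, hy, hy0⟩ := intermediate_value_Icc' hs.1
      (cu.mono (Icc_subset_Icc le_rfl (hs.2.le.trans hz.1.2)))
      (show (0:ℝ) ∈ Icc (u s) (u 0) from ⟨hc, h.pos_zero.le⟩)
    rcases hy.1.eq_or_lt with h0 | h0
    · rw [← h0] at hy0
      linarith
    · exact hz.2.2 y ⟨h0, hy.2.trans_lt hs.2⟩ hy0

theorem statement7 (N : ℕ) (hN : N = 3 ∨ N = 4 ∨ N = 5 ∨ N = 6)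
    (m : ℕ) (hm : 2 ≤ m) (lamBar : ℝ) (hlamBar : 0 < lamBar)
    (lam : ℕ → ℝ) (hlam : Tendsto lam atTop (𝓝 lamBar))
    (u u' u'' : ℕ → ℝ → ℝ) (r : ℕ → ℝ)
    (hsol : ∀ n, BNSol N (lam n) m (u n) (u' n) (u'' n))
    (hfz : ∀ n, IsFirstZero (u n) (r n))
    (hblow : Tendsto (fun n => u n 0) atTop atTop)
    (M : ℕ → ℝ) (hM : ∀ n, M n = sSup ((fun s => |u n s|) '' Set.Icc (r n) 1)) :
    ((N = 3 ∨ N = 4 ∨ N = 5) → Tendsto M atTop (𝓝 0)) ∧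
    (N = 6 → ∃ C : ℝ, ∀ n, M n ≤ C) := by
  obtain ⟨k, rfl, hk1, hk4⟩ : ∃ k, N = k + 2 ∧ 1 ≤ k ∧ k ≤ 4 := ⟨N - 2, by omega, by omega, by omega⟩
  have hk0 : (0:ℝ) < k := by exact_mod_cast hk1
  have hq0 : 0 < 4 / (k:ℝ) := by positivity
  -- eventually the working hypotheses hold
  have hW : ∀ᶠ n in atTop, Work k (4 / (k:ℝ)) (lam n) (r n) (u n) (u' n) (u'' n) := by
    have hpow : Tendsto (fun n => u n 0 ^ (4 / (k:ℝ))) atTop atTop :=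
      (tendsto_rpow_atTop hq0).comp hblow
    filter_upwards [hlam.eventually_const_lt hlamBar, hlam.eventually_lt_const (lt_add_one lamBar),
      hblow.eventually_ge_atTop 1, hpow.eventually_ge_atTop (lamBar + 1)] with n h1 h2 h3 h4
    exact (hsol n).work hk1 (hfz n) h1 h3 (h2.le.trans h4)
  have hM' : ∀ᶠ n in atTop, 0 ≤ M n ∧ M n ≤ 2 / k / ((1/2) ^ (4 / (k:ℝ)) * (1/2) / (k+2)) *
      (Work.P k (4 / (k:ℝ)) (lam n) (u n) (u' n) (r n) * u n 0) := by
    filter_upwards [hW] with n hn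
    rw [hM n]
    constructor
    · apply Real.sSup_nonneg
      rintro _ ⟨s, _, rfl⟩
      exact abs_nonneg _
    · refine csSup_le ((nonempty_Icc.2 hn.rho1).image _) ?_
      rintro _ ⟨s, hs, rfl⟩
      exact hn.outer_P hs
  have hK : 0 < 2 / k / ((1/2:ℝ) ^ (4 / (k:ℝ)) * (1/2) / (k+2)) := by positivity
  generalize 2 / k / ((1/2:ℝ) ^ (4 / (k:ℝ)) * (1/2) / (k+2)) = K at hM' hK
  constructor
  · intro hN'
    have hk3 : k ≤ 3 := by omega
    have hlim : Tendsto (fun n => K * ((lam n * (5 * ((4 / (k:ℝ) / 4 / (k+2)) ^ (-(k/2:ℝ))) ^ (8/5:ℝ)))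
        * u n 0 ^ (-(1/5):ℝ))) atTop (𝓝 0) := by
      have h1 : Tendsto (fun n => u n 0 ^ (-(1/5):ℝ)) atTop (𝓝 0) :=
        (tendsto_rpow_neg_atTop (by norm_num)).comp hblow
      simpa using ((hlam.mul_const (5 * ((4 / (k:ℝ) / 4 / (k+2)) ^ (-(k/2:ℝ))) ^ (8/5:ℝ))).mul h1).const_mul K
    refine tendsto_of_tendsto_of_tendsto_of_le_of_le' tendsto_const_nhds hlim
      (hM'.mono fun n hn => hn.1) ?_
    filter_upwards [hM', hW] with n hn hw
    refine hn.2.trans ?_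
    have hA : 0 < u n 0 := zero_lt_one.trans_le hw.hA
    refine mul_le_mul_of_nonneg_left ?_ hK.le
    refine (mul_le_mul_of_nonneg_right (hw.P_upper_low hk3) hA.le).trans_eq ?_
    rw [mul_assoc _ _ (u n 0)]
    congr 1
    nth_rewrite 2 [← rpow_one (u n 0)]
    rw [← rpow_add hA]
    norm_num
  · intro hN'
    have hk4' : k = 4 := by omega
    have hev : ∀ᶠ n in atTop, M n ≤
        K * ((lamBar + 1) * (12 * (4 / (k:ℝ) / 4 / (k+2)) ^ (-(k/2:ℝ)))) := by
      filter_upwards [hM', hW, hlam.eventually_lt_const (lt_add_one lamBar)] with n hn hw hl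
      refine hn.2.trans ?_
      refine mul_le_mul_of_nonneg_left ?_ hK.le
      refine (hw.P_upper_six hk4').trans ?_
      gcongr
    have hb : IsBoundedUnder (· ≤ ·) atTop M := ⟨_, eventually_map.2 hev⟩
    obtain ⟨C, hC⟩ := hb.bddAbove_range
    exact ⟨C, fun n => hC ⟨n, rfl⟩⟩
end

section
/- Let N ≥ 3, m ≥ 1, and let u₁, u₂ ∈ C²([0,1],ℝ) be radial solutions of the Brezis–Nirenberg problem with m nodal zones for parameters λ₁ > 0 and λ₂ > 0 respectively. If u₁(0)/λ₁^{(N−2)/4} = u₂(0)/λ₂^{(N−2)/4}, then λ₁ = λ₂ and u₁ ≡ u₂ on [0,1]. -/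
open Real Set Filter Topology

lemma bn_g_deriv (q : ℝ) (hq : 0 < q) (t : ℝ) :
    HasDerivAt (fun x : ℝ => |x| ^ q * x) ((q + 1) * |t| ^ q) t := by
  rcases lt_trichotomy t 0 with ht | ht | ht
  · have h1 : HasDerivAt (fun x : ℝ => (-x) ^ q * x)
        ((-1) * q * (-t) ^ (q - 1) * t + (-t) ^ q * 1) t :=
      ((hasDerivAt_neg t).rpow_const (Or.inl (by linarith))).mul (hasDerivAt_id t)
    have h2 : (-1) * q * (-t) ^ (q - 1) * t + (-t) ^ q * 1 = (q + 1) * |t| ^ q := by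
      rw [abs_of_neg ht, Real.rpow_sub_one (by linarith : -t ≠ 0)]
      have : t ≠ 0 := ht.ne
      field_simp
      try ring
    rw [h2] at h1
    refine h1.congr_of_eventuallyEq ?_
    filter_upwards [Iio_mem_nhds ht] with x hx
    rw [abs_of_neg hx]
  · subst ht
    rw [hasDerivAt_iff_tendsto_slope]
    have hc : Continuous (fun x : ℝ => |x| ^ q) :=
      continuous_abs.rpow_const (fun _ => Or.inr hq.le)
    have h0 : Tendsto (fun x : ℝ => |x| ^ q) (𝓝[≠] 0) (𝓝 ((q + 1) * |(0:ℝ)| ^ q)) := by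
      have := (hc.tendsto 0).mono_left (nhdsWithin_le_nhds (s := {0}ᶜ))
      simpa [Real.zero_rpow hq.ne'] using this
    refine h0.congr' ?_
    filter_upwards [self_mem_nhdsWithin] with x hx
    have hx : x ≠ 0 := hx
    simp [slope_def_field, hx]
  · have h1 : HasDerivAt (fun x : ℝ => x ^ q * x)
        (1 * q * t ^ (q - 1) * t + t ^ q * 1) t :=
      ((hasDerivAt_id t).rpow_const (Or.inl ht.ne')).mul (hasDerivAt_id t)
    have h2 : 1 * q * t ^ (q - 1) * t + t ^ q * 1 = (q + 1) * |t| ^ q := by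
      rw [abs_of_pos ht, Real.rpow_sub_one ht.ne']
      field_simp
      try ring
    rw [h2] at h1
    refine h1.congr_of_eventuallyEq ?_
    filter_upwards [Ioi_mem_nhds ht] with x hx
    rw [abs_of_pos hx]

lemma bn_g_lip (q : ℝ) (hq : 0 < q) (M : ℝ) (a b : ℝ) (ha : |a| ≤ M) (hb : |b| ≤ M) :
    |(|a| ^ q * a) - (|b| ^ q * b)| ≤ ((q + 1) * M ^ q) * |a - b| := by
  have h := Convex.norm_image_sub_le_of_norm_hasDerivWithin_le (s := Icc (-M) M)
    (f := fun x : ℝ => |x| ^ q * x) (f' := fun t => (q + 1) * |t| ^ q) (C := (q + 1) * M ^ q)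
    (x := b) (y := a)
    (fun x _ => (bn_g_deriv q hq x).hasDerivWithinAt)
    (fun x hx => by
      have hx' : |x| ≤ M := abs_le.2 hx
      rw [Real.norm_eq_abs, abs_of_nonneg (by positivity)]
      gcongr)
    (convex_Icc _ _) (abs_le.1 hb) (abs_le.1 ha)
  simpa [Real.norm_eq_abs] using h

/-- Uniqueness for the singular initial value problem. -/
lemma bn_unique (q lam k : ℝ) (hq : 0 < q) (hk : 0 ≤ k) (a a' a'' b b' b'' : ℝ → ℝ)
    (ha : ∀ r ∈ Icc (0:ℝ) 1, HasDerivWithinAt a (a' r) (Icc (0:ℝ) 1) r)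
    (ha' : ∀ r ∈ Icc (0:ℝ) 1, HasDerivWithinAt a' (a'' r) (Icc (0:ℝ) 1) r)
    (hb : ∀ r ∈ Icc (0:ℝ) 1, HasDerivWithinAt b (b' r) (Icc (0:ℝ) 1) r)
    (hb' : ∀ r ∈ Icc (0:ℝ) 1, HasDerivWithinAt b' (b'' r) (Icc (0:ℝ) 1) r)
    (oa : ∀ r ∈ Ioo (0:ℝ) 1, a'' r + (k / r) * a' r + |a r| ^ q * a r + lam * a r = 0)
    (ob : ∀ r ∈ Ioo (0:ℝ) 1, b'' r + (k / r) * b' r + |b r| ^ q * b r + lam * b r = 0)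
    (h0 : a 0 = b 0) (h0' : a' 0 = b' 0) : ∀ r ∈ Icc (0:ℝ) 1, a r = b r := by
  have hca : ContinuousOn a (Icc 0 1) := fun r hr => (ha r hr).continuousWithinAt
  have hcb : ContinuousOn b (Icc 0 1) := fun r hr => (hb r hr).continuousWithinAt
  obtain ⟨Ma, hMa⟩ := isCompact_Icc.exists_bound_of_continuousOn hca
  obtain ⟨Mb, hMb⟩ := isCompact_Icc.exists_bound_of_continuousOn hcb
  set M := max Ma Mb with hM
  have hM0 : 0 ≤ M := (norm_nonneg _).trans ((hMa 0 (by simp)).trans (le_max_left _ _))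
  set L := (q + 1) * M ^ q with hL
  have hL0 : 0 ≤ L := by positivity
  set C := L + |lam| + 1 with hC
  have hC0 : 0 ≤ C := by positivity
  let D : ℝ → ℝ := fun r => Real.exp (-C * r) * ((a' r - b' r) ^ 2 + (a r - b r) ^ 2)
  let D' : ℝ → ℝ := fun r => Real.exp (-C * r) * (-C) * ((a' r - b' r) ^ 2 + (a r - b r) ^ 2)
    + Real.exp (-C * r) * (2 * (a' r - b' r) * (a'' r - b'' r) + 2 * (a r - b r) * (a' r - b' r))
  have hD : ∀ r ∈ Icc (0:ℝ) 1, HasDerivWithinAt D (D' r) (Icc (0:ℝ) 1) r := by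
    intro r hr
    have e1 : HasDerivWithinAt (fun r : ℝ => Real.exp (-C * r)) (Real.exp (-C * r) * (-C))
        (Icc (0:ℝ) 1) r := by
      have := ((hasDerivAt_id r).const_mul (-C)).exp
      simpa using this.hasDerivWithinAt
    have e2 := ((ha' r hr).sub (hb' r hr)).pow 2
    have e3 := ((ha r hr).sub (hb r hr)).pow 2
    have := e1.mul (e2.add e3)
    refine this.congr_deriv ?_
    simp [D']
  have hanti : AntitoneOn D (Icc 0 1) := by
    refine antitoneOn_of_hasDerivWithinAt_nonpos (convex_Icc _ _) (f' := D')
      (fun r hr => (hD r hr).continuousWithinAt) ?_ ?_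
    · intro r hr
      exact (hD r (interior_subset hr)).mono interior_subset
    · intro r hr
      rw [interior_Icc] at hr
      have hrI : r ∈ Icc (0:ℝ) 1 := ⟨hr.1.le, hr.2.le⟩
      have hlip := bn_g_lip q hq M (a r) (b r) ((hMa r hrI).trans (le_max_left _ _))
        ((hMb r hrI).trans (le_max_right _ _))
      have e1 := oa r hr
      have e2 := ob r hr
      set x := a' r - b' r with hx
      set y := a r - b r with hy
      set G := |a r| ^ q * a r - |b r| ^ q * b r with hG
      have e3 : a'' r - b'' r = -(k / r) * x - G - lam * y := by
        rw [hx, hy, hG]; linear_combination e1 - e2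
      have hkr : 0 ≤ k / r * x ^ 2 := by
        have := hr.1
        positivity
      have key : -C * (x ^ 2 + y ^ 2) + (2 * x * (a'' r - b'' r) + 2 * y * x) ≤ 0 := by
        rw [e3]
        have i1 : -(x * G) ≤ |x| * (L * |y|) := by
          calc -(x * G) ≤ |x * G| := neg_le_abs _
            _ = |x| * |G| := abs_mul _ _
            _ ≤ _ := by gcongr
        have i2 : -(x * (lam * y)) ≤ |x| * (|lam| * |y|) := by
          calc -(x * (lam * y)) ≤ |x * (lam * y)| := neg_le_abs _
            _ = _ := by rw [abs_mul, abs_mul]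
        have i3 : x * y ≤ |x| * |y| := by
          rw [← abs_mul]; exact le_abs_self _
        have i4 : C * (2 * (|x| * |y|)) ≤ C * (x ^ 2 + y ^ 2) := by
          refine mul_le_mul_of_nonneg_left ?_ hC0
          rw [← sq_abs x, ← sq_abs y]
          nlinarith [sq_nonneg (|x| - |y|)]
        have i5 : C * (2 * (|x| * |y|)) =
            2 * (|x| * (L * |y|)) + 2 * (|x| * (|lam| * |y|)) + 2 * (|x| * |y|) := by
          rw [hC]; ring
        nlinarith
      have : D' r = Real.exp (-C * r) *
          (-C * (x ^ 2 + y ^ 2) + (2 * x * (a'' r - b'' r) + 2 * y * x)) := by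
        simp only [D', ← hx, ← hy]; ring
      rw [this]
      exact mul_nonpos_of_nonneg_of_nonpos (Real.exp_pos _).le key
  intro r hr
  have h1 := hanti (by simp : (0:ℝ) ∈ Icc (0:ℝ) 1) hr hr.1
  have h2 : D 0 = 0 := by simp [D, h0, h0']
  rw [h2] at h1
  have h3 : (a' r - b' r) ^ 2 + (a r - b r) ^ 2 ≤ 0 := by
    by_contra hcon
    push Not at hcon
    exact absurd h1 (not_le.2 (mul_pos (Real.exp_pos _) hcon))
  have h4 : (a r - b r) ^ 2 = 0 := by nlinarith [sq_nonneg (a' r - b' r), sq_nonneg (a r - b r)]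
  have := pow_eq_zero_iff (two_ne_zero) |>.1 h4
  linarith

lemma bn_q_pos (N : ℕ) (hN : 3 ≤ N) : (0:ℝ) < 4 / ((N:ℝ) - 2) := by
  have : (3:ℝ) ≤ N := by exact_mod_cast hN
  exact div_pos (by norm_num) (by linarith)

/-- Zeros are simple. -/
lemma bn_simple (N : ℕ) (hN : 3 ≤ N) (m : ℕ) (lam : ℝ) (hlam : 0 < lam) (u u' u'' : ℝ → ℝ)
    (hs : BNSol N lam m u u' u'') (r₀ : ℝ) (hr₀ : r₀ ∈ Ioc (0:ℝ) 1) (hu : u r₀ = 0) :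
    u' r₀ ≠ 0 := by
  intro hu'
  have hq := bn_q_pos N hN
  set q := (4:ℝ) / ((N:ℝ) - 2) with hqdef
  have hN3 : (3:ℝ) ≤ N := by exact_mod_cast hN
  let E : ℝ → ℝ := fun r => (u' r) ^ 2 / 2 + |u r| ^ (q + 2) / (q + 2) + lam * (u r) ^ 2 / 2
  let E' : ℝ → ℝ := fun r => u' r * u'' r + |u r| ^ q * u r * u' r + lam * u r * u' r
  have hE : ∀ r ∈ Icc (0:ℝ) 1, HasDerivWithinAt E (E' r) (Icc (0:ℝ) 1) r := by
    intro r hr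
    have e1 := ((hs.deriv_snd r hr).pow 2).div_const 2
    have e2 := (((hasDerivAt_abs_rpow (u r) (by linarith : 1 < q + 2)).comp_hasDerivWithinAt r
      (hs.deriv_fst r hr))).div_const (q + 2)
    have e3 := (((hs.deriv_fst r hr).pow 2).const_mul lam).div_const 2
    refine ((e1.add e2).add e3).congr_deriv ?_
    have : q + 2 - 2 = q := by ring
    rw [this]
    simp only [E']
    have : q + 2 ≠ 0 := by positivity
    field_simp
    try ring
  let P : ℝ → ℝ := fun r => r ^ (2 * N) * E r
  let P' : ℝ → ℝ := fun r => ((2 * N : ℕ) : ℝ) * r ^ (2 * N - 1) * E r + r ^ (2 * N) * E' r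
  have hP : ∀ r ∈ Icc (0:ℝ) 1, HasDerivWithinAt P (P' r) (Icc (0:ℝ) 1) r := by
    intro r hr
    exact ((hasDerivAt_pow (2 * N) r).hasDerivWithinAt).mul (hE r hr)
  have hmono : MonotoneOn P (Icc 0 1) := by
    refine monotoneOn_of_hasDerivWithinAt_nonneg (convex_Icc _ _) (f' := P')
      (fun r hr => (hP r hr).continuousWithinAt) ?_ ?_
    · intro r hr
      exact (hP r (interior_subset hr)).mono interior_subset
    · intro r hr
      rw [interior_Icc] at hr
      have hr0 := hr.1
      have e1 := hs.ode r hr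
      rw [← hqdef] at e1
      have e2 : E' r = -(((N:ℝ) - 1) / r * (u' r) ^ 2) := by
        simp only [E']; linear_combination (u' r) * e1
      have e3 : r ^ (2 * N) = r ^ (2 * N - 1) * r := by
        rw [← pow_succ]; congr 1; omega
      have e4 : P' r = r ^ (2 * N - 1) * (2 * N * E r - ((N:ℝ) - 1) * (u' r) ^ 2) := by
        simp only [P']
        rw [e2, e3]; push_cast
        field_simp
        try ring
      rw [e4]
      refine mul_nonneg (by positivity) ?_
      have e5 : (u' r) ^ 2 ≤ 2 * E r := by
        simp only [E]
        have : 0 ≤ |u r| ^ (q + 2) / (q + 2) := by positivity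
        have : 0 ≤ lam * (u r) ^ 2 / 2 := by positivity
        linarith
      nlinarith [sq_nonneg (u' r)]
  have hc : ContinuousWithinAt u (Icc 0 1) 0 := (hs.deriv_fst 0 (by simp)).continuousWithinAt
  have hev := hc.eventually (lt_mem_nhds hs.pos_zero)
  have hev2 : ∀ᶠ r in 𝓝[>] (0:ℝ), 0 < u r := by
    refine hev.filter_mono ?_
    rw [← nhdsWithin_Ioc_eq_nhdsGT (zero_lt_one (α := ℝ))]
    exact nhdsWithin_mono _ Ioc_subset_Icc_self
  obtain ⟨r, hur, hr⟩ := (hev2.and (Ioc_mem_nhdsGT hr₀.1)).exists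
  have h1 := hmono ⟨hr.1.le, hr.2.trans hr₀.2⟩ ⟨hr₀.1.le, hr₀.2⟩ hr.2
  have h2 : P r₀ = 0 := by
    simp [P, E, hu, hu', Real.zero_rpow (by positivity : q + 2 ≠ 0)]
  have h3 : 0 < P r := by
    have := hr.1
    simp only [P, E]
    positivity
  linarith

lemma bn_finite (N : ℕ) (hN : 3 ≤ N) (m : ℕ) (lam : ℝ) (hlam : 0 < lam) (u u' u'' : ℝ → ℝ)
    (hs : BNSol N lam m u u' u'') : {r : ℝ | r ∈ Ioo (0:ℝ) 1 ∧ u r = 0}.Finite := by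
  by_contra hinf
  have hinf : {r : ℝ | r ∈ Ioo (0:ℝ) 1 ∧ u r = 0}.Infinite := hinf
  obtain ⟨x, hx, hacc⟩ := hinf.exists_accPt_of_subset_isCompact (isCompact_Icc (a := (0:ℝ)) (b := 1))
    (fun r hr => ⟨hr.1.1.le, hr.1.2.le⟩)
  rw [accPt_iff_frequently_nhdsNE] at hacc
  have hfr : ∃ᶠ y in 𝓝[Icc 0 1 \ {x}] x, u y = 0 := by
    rw [frequently_nhdsWithin_iff] at hacc ⊢
    refine hacc.mono ?_
    rintro y ⟨⟨h1, h2⟩, h3⟩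
    exact ⟨h2, ⟨h1.1.le, h1.2.le⟩, h3⟩
  have hd := hs.deriv_fst x hx
  have hux : u x = 0 := by
    by_contra hne
    have := hd.continuousWithinAt.eventually_ne hne
    exact hfr ((this.filter_mono (nhdsWithin_mono _ sdiff_subset)))
  have hx0 : 0 < x := by
    rcases hx.1.eq_or_lt with h | h
    · rw [← h] at hux
      exact absurd hux hs.pos_zero.ne'
    · exact h
  have hne := bn_simple N hN m lam hlam u u' u'' hs x ⟨hx0, hx.2⟩ hux
  exact hfr (hd.eventually_ne hne)

lemma bn_main (N : ℕ) (hN : 3 ≤ N) (m : ℕ) (hm : 1 ≤ m)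
    (lam₁ lam₂ : ℝ) (hlam₁ : 0 < lam₁) (hlam₂ : 0 < lam₂)
    (u₁ u₁' u₁'' u₂ u₂' u₂'' : ℝ → ℝ)
    (hs₁ : BNSol N lam₁ m u₁ u₁' u₁'')
    (hs₂ : BNSol N lam₂ m u₂ u₂' u₂'')
    (heq : u₁ 0 / lam₁ ^ (((N:ℝ) - 2) / 4) = u₂ 0 / lam₂ ^ (((N:ℝ) - 2) / 4))
    (hle : lam₁ ≤ lam₂) :
    lam₁ = lam₂ ∧ ∀ r ∈ Set.Icc (0:ℝ) 1, u₁ r = u₂ r := by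
  have hN3 : (3:ℝ) ≤ N := by exact_mod_cast hN
  have hq := bn_q_pos N hN
  set k := Real.sqrt (lam₁ / lam₂) with hk
  set c := (lam₁ / lam₂) ^ (((N:ℝ) - 2) / 4) with hc
  have hd0 : 0 < lam₁ / lam₂ := div_pos hlam₁ hlam₂
  have hk0 : 0 < k := Real.sqrt_pos.2 hd0
  have hk2 : k ^ 2 = lam₁ / lam₂ := Real.sq_sqrt hd0.le
  have hk1 : k ≤ 1 := Real.sqrt_le_one.2 ((div_le_one hlam₂).2 hle)
  have hc0 : 0 < c := Real.rpow_pos_of_pos hd0 _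
  have hcq : c ^ ((4:ℝ) / ((N:ℝ) - 2)) = k ^ 2 := by
    rw [hk2, hc, ← Real.rpow_mul hd0.le]
    have : ((N:ℝ) - 2) / 4 * (4 / ((N:ℝ) - 2)) = 1 := by
      have : (N:ℝ) - 2 ≠ 0 := by linarith
      field_simp
    rw [this, Real.rpow_one]
  have hkl : k ^ 2 * lam₂ = lam₁ := by rw [hk2]; field_simp
  have hinit : u₁ 0 = c * u₂ 0 := by
    rw [hc, Real.div_rpow hlam₁.le hlam₂.le]
    have p1 := (Real.rpow_pos_of_pos hlam₁ (((N:ℝ) - 2) / 4)).ne'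
    have p2 := (Real.rpow_pos_of_pos hlam₂ (((N:ℝ) - 2) / 4)).ne'
    field_simp at heq ⊢
    linarith
  have hmap : MapsTo (fun r : ℝ => k * r) (Icc 0 1) (Icc 0 1) := fun r hr =>
    ⟨mul_nonneg hk0.le hr.1, mul_le_one₀ hk1 hr.1 hr.2⟩
  have hkd : ∀ r : ℝ, HasDerivWithinAt (fun r : ℝ => k * r) k (Icc 0 1) r := fun r => by
    simpa using ((hasDerivAt_id r).const_mul k).hasDerivWithinAt (s := Icc (0:ℝ) 1)
  have huniq := bn_unique ((4:ℝ) / ((N:ℝ) - 2)) lam₁ ((N:ℝ) - 1) hq (by linarith) u₁ u₁' u₁''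
    (fun r => c * u₂ (k * r)) (fun r => c * (u₂' (k * r) * k))
    (fun r => c * (u₂'' (k * r) * k * k)) hs₁.deriv_fst hs₁.deriv_snd
    (fun r hr => ((hs₂.deriv_fst (k * r) (hmap hr)).comp r (hkd r) hmap).const_mul c)
    (fun r hr =>
      (((hs₂.deriv_snd (k * r) (hmap hr)).comp r (hkd r) hmap).mul_const k).const_mul c)
    hs₁.ode
    (by
      intro r hr
      have hr0 := hr.1
      have hkr : k * r ∈ Ioo (0:ℝ) 1 :=
        ⟨mul_pos hk0 hr.1, by nlinarith [hr.2]⟩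
      have e := hs₂.ode (k * r) hkr
      have e' : ((N:ℝ) - 1) / (k * r) * k = ((N:ℝ) - 1) / r := by field_simp
      beta_reduce
      rw [abs_mul, abs_of_pos hc0, Real.mul_rpow hc0.le (abs_nonneg _), hcq, ← hkl, ← e']
      linear_combination c * k ^ 2 * e)
    (by simpa using hinit)
    (by simp [hs₁.bc_deriv_zero, hs₂.bc_deriv_zero])
  rcases hle.eq_or_lt with h | h
  · refine ⟨h, fun r hr => ?_⟩
    have hk1 : k = 1 := by rw [hk, h, div_self hlam₂.ne', Real.sqrt_one]
    have hc1 : c = 1 := by rw [hc, h, div_self hlam₂.ne', Real.one_rpow]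
    have := huniq r hr
    simpa [hk1, hc1] using this
  · exfalso
    have hklt : k < 1 := by
      rw [hk, Real.sqrt_lt' one_pos]
      simpa using (div_lt_one hlam₂).2 h
    have hz : ∀ r ∈ Icc (0:ℝ) 1, u₁ r = 0 → u₂ (k * r) = 0 := by
      intro r hr h0
      have := huniq r hr
      beta_reduce at this
      rw [h0] at this
      rcases mul_eq_zero.1 this.symm with h | h
      · exact absurd h hc0.ne'
      · exact h
    have f1 := bn_finite N hN m lam₁ hlam₁ u₁ u₁' u₁'' hs₁
    have f2 := bn_finite N hN m lam₂ hlam₂ u₂ u₂' u₂'' hs₂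
    set Z₁ := {r : ℝ | r ∈ Ioo (0:ℝ) 1 ∧ u₁ r = 0} with hZ₁
    have hsub : (fun r : ℝ => k * r) '' (insert 1 Z₁) ⊆ {r : ℝ | r ∈ Ioo (0:ℝ) 1 ∧ u₂ r = 0} := by
      rintro _ ⟨r, hr, rfl⟩
      rcases hr with rfl | hr
      · exact ⟨⟨by simpa using hk0, by simpa using hklt⟩, hz 1 (by simp) hs₁.bc_one⟩
      · exact ⟨⟨mul_pos hk0 hr.1.1, by nlinarith [hr.1.2, hr.1.1]⟩,
          hz r ⟨hr.1.1.le, hr.1.2.le⟩ hr.2⟩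
    have h1 := Set.ncard_le_ncard hsub f2
    rw [Set.ncard_image_of_injective _ (mul_right_injective₀ hk0.ne'),
      Set.ncard_insert_of_notMem (by simp [hZ₁]) f1, hs₁.nodal, hs₂.nodal] at h1
    omega

theorem statement8 (N : ℕ) (hN : 3 ≤ N) (m : ℕ) (hm : 1 ≤ m)
    (lam₁ lam₂ : ℝ) (hlam₁ : 0 < lam₁) (hlam₂ : 0 < lam₂)
    (u₁ u₁' u₁'' u₂ u₂' u₂'' : ℝ → ℝ)
    (hs₁ : BNSol N lam₁ m u₁ u₁' u₁'')
    (hs₂ : BNSol N lam₂ m u₂ u₂' u₂'')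
    (heq : u₁ 0 / lam₁ ^ (((N:ℝ) - 2) / 4) = u₂ 0 / lam₂ ^ (((N:ℝ) - 2) / 4)) :
    lam₁ = lam₂ ∧ ∀ r ∈ Set.Icc (0:ℝ) 1, u₁ r = u₂ r := by
  rcases le_total lam₁ lam₂ with h | h
  · exact bn_main N hN m hm lam₁ lam₂ hlam₁ hlam₂ u₁ u₁' u₁'' u₂ u₂' u₂'' hs₁ hs₂ heq h
  · obtain ⟨h1, h2⟩ := bn_main N hN m hm lam₂ lam₁ hlam₂ hlam₁ u₂ u₂' u₂'' u₁ u₁' u₁''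
      hs₂ hs₁ heq.symm h
    exact ⟨h1.symm, fun r hr => (h2 r hr).symm⟩
end
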